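/- arXiv:1701.07064 — 2 statements merged into one kernel-verified Lean document; each statement's English description precedes it below -/
import Mathlib

section
/- Let χ₋₄ be the unique nonprincipal Dirichlet character modulo 4. Then the derivative at s = 1 of the entire function s ↦ 4^s·L(χ₋₄, s) equals π²/3 + π·γ + 4π·Σ_{ℓ=1}^∞ 1/( ℓ·(e^{2πℓ} − 1) ). -/
open Complex Real

/-- Gaussian integers of norm `n`. -/
def gaussSet (n : ℕ) : Set GaussianInt := {z | z.norm = (n : ℤ)}

lemma gaussSet_finite (n : ℕ) : (gaussSet n).Finite := by
  refine Set.Finite.subset (s := (fun p : ℤ × ℤ => (⟨p.1, p.2⟩ : GaussianInt)) ''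
    ((Finset.Icc (-(n : ℤ)) n ×ˢ Finset.Icc (-(n : ℤ)) n : Finset (ℤ × ℤ)) : Set (ℤ × ℤ)))
    (Set.Finite.image _ (Finset.finite_toSet _)) ?_
  rintro ⟨x, y⟩ hz
  simp only [gaussSet, Set.mem_ofPred_eq, Zsqrtd.norm_def] at hz
  refine ⟨(x, y), ?_, rfl⟩
  simp only [Finset.coe_product, Finset.coe_Icc, Set.mem_prod, Set.mem_Icc]
  refine ⟨⟨?_, ?_⟩, ⟨?_, ?_⟩⟩ <;> nlinarith [sq_nonneg x, sq_nonneg y, Int.le_self_sq x, Int.le_self_sq y, Int.le_self_sq (-x), Int.le_self_sq (-y)]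

noncomputable def rr (n : ℕ) : ℕ := (gaussSet n).ncard

lemma rr_dvd (a : GaussianInt) (q n : ℕ) (hq : q ≠ 0) (ha : a.norm = (q : ℤ)) :
    ({z | z ∈ gaussSet (q * n) ∧ a ∣ z} : Set GaussianInt).ncard = rr n := by
  have ha0 : a ≠ 0 := by
    rintro rfl
    simp at ha
    exact hq (by exact_mod_cast ha.symm)
  have : ({z | z ∈ gaussSet (q * n) ∧ a ∣ z} : Set GaussianInt) = (fun w => a * w) '' gaussSet n := by
    ext z
    simp only [gaussSet, Set.mem_ofPred_eq, Set.mem_image]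
    constructor
    · rintro ⟨h, w, rfl⟩
      refine ⟨w, ?_, rfl⟩
      rw [Zsqrtd.norm_mul, ha] at h
      push_cast at h
      exact mul_left_cancel₀ (by exact_mod_cast hq) h
    · rintro ⟨w, hw, rfl⟩
      refine ⟨?_, dvd_mul_right _ _⟩
      rw [Zsqrtd.norm_mul, ha, hw]; push_cast; ring
  rw [this, Set.ncard_image_of_injective _ (mul_right_injective₀ ha0), rr]

lemma gauss_prime_of_norm (a : GaussianInt) (p : ℕ) (hp : p.Prime) (ha : a.norm = (p : ℤ)) :
    Prime a := by
  rw [← irreducible_iff_prime]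
  refine ⟨fun h => ?_, fun b c h => ?_⟩
  · have := Zsqrtd.norm_eq_one_iff.2 h
    rw [ha] at this; simp at this; exact hp.one_lt.ne' this
  · have h1 : b.norm.natAbs * c.norm.natAbs = p := by
      rw [← Int.natAbs_mul, ← Zsqrtd.norm_mul, ← h, ha]; simp
    rw [← Zsqrtd.norm_eq_one_iff, ← Zsqrtd.norm_eq_one_iff]
    rcases (Nat.prime_mul_iff.1 (h1 ▸ hp)) with h | h
    · exact Or.inr h.2
    · exact Or.inl h.2

lemma gauss_norm_conj (z : GaussianInt) : ((z.norm : ℤ) : GaussianInt) = z * star z :=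
  Zsqrtd.norm_eq_mul_conj z

lemma dvd_or_star_dvd (a : GaussianInt) (p n : ℕ) (hp : Prime a) (ha : a ∣ (p : GaussianInt))
    (z : GaussianInt) (hz : z ∈ gaussSet (p * n)) : a ∣ z ∨ star a ∣ z := by
  have h1 : a ∣ z * star z := by
    rw [← gauss_norm_conj, hz]
    push_cast
    exact ha.mul_right _
  rcases hp.dvd_or_dvd h1 with h | h
  · exact Or.inl h
  · right
    obtain ⟨w, hw⟩ := h
    exact ⟨star w, by rw [← star_mul', ← hw, star_star]⟩

lemma rr_two (n : ℕ) : rr (2 * n) = rr n := by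
  rw [← rr_dvd ⟨1, 1⟩ 2 n (by norm_num) (by simp [Zsqrtd.norm_def]), rr]
  congr 1
  ext z
  simp only [Set.mem_ofPred_eq, iff_self_and]
  intro hz
  have hP : Prime (⟨1, 1⟩ : GaussianInt) :=
    gauss_prime_of_norm _ 2 Nat.prime_two (by simp [Zsqrtd.norm_def])
  have := dvd_or_star_dvd ⟨1, 1⟩ 2 n hP ⟨⟨1, -1⟩, by ext <;> simp⟩ z hz
  rcases this with h | h
  · exact h
  · exact Dvd.dvd.trans ⟨⟨0, -1⟩, by ext <;> simp⟩ h

lemma rr_three (p n : ℕ) (hp : p.Prime) (h3 : p % 4 = 3) :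
    rr (p * n) = if p ∣ n then rr (n / p) else 0 := by
  have := Fact.mk hp
  have hP := GaussianInt.prime_of_nat_prime_of_mod_four_eq_three p h3
  have hd : ∀ z ∈ gaussSet (p * n), (p : GaussianInt) ∣ z := by
    intro z hz
    have := dvd_or_star_dvd p p n hP dvd_rfl z hz
    simpa using this
  have hnp : (p : GaussianInt).norm = ((p * p : ℕ) : ℤ) := by simp [Zsqrtd.norm_def]
  split_ifs with h
  · obtain ⟨m, rfl⟩ := h
    rw [Nat.mul_div_cancel_left _ hp.pos, ← rr_dvd p (p * p) m (by simp [hp.ne_zero]) hnp, rr]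
    congr 1
    ext z
    simp only [Set.mem_ofPred_eq, mul_assoc, iff_self_and]
    exact hd z
  · rw [rr, Set.ncard_eq_zero (gaussSet_finite _), Set.eq_empty_iff_forall_notMem]
    intro z hz
    obtain ⟨w, rfl⟩ := hd z hz
    simp only [gaussSet, Set.mem_ofPred_eq, Zsqrtd.norm_mul, hnp] at hz
    apply h
    have h2 : (p : ℤ) * (p * w.norm) = p * n := by push_cast at hz; linarith
    have := mul_left_cancel₀ (by exact_mod_cast hp.ne_zero) h2
    exact_mod_cast (Dvd.intro _ this : (p : ℤ) ∣ n)

lemma rr_one_mod (p n : ℕ) (hp : p.Prime) (h1 : p % 4 = 1) :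
    rr (p * n) + (if p ∣ n then rr (n / p) else 0) = 2 * rr n := by
  have := Fact.mk hp
  obtain ⟨a, b, hab⟩ := Nat.Prime.sq_add_sq (p := p) (by omega)
  set P : GaussianInt := ⟨a, b⟩ with hPdef
  have hN : P.norm = (p : ℤ) := by simp [hPdef, Zsqrtd.norm_def, ← hab]; ring
  have hN' : (star P).norm = (p : ℤ) := by rw [Zsqrtd.norm_conj, hN]
  have hP := gauss_prime_of_norm P p hp hN
  have hP' := gauss_prime_of_norm (star P) p hp hN'
  have hprod : (p : GaussianInt) = P * star P := by
    rw [← gauss_norm_conj, hN]; simp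
  have hnd : ¬ star P ∣ P := by
    intro h
    have h2 : star P ∣ ((2 * a : ℤ) : GaussianInt) := by
      have : ((2 * a : ℤ) : GaussianInt) = P + star P := by
        ext <;> simp [hPdef, two_mul]
      rw [this]; exact dvd_add h dvd_rfl
    obtain ⟨w, hw⟩ := h2
    have h3 := congrArg Zsqrtd.norm hw
    rw [Zsqrtd.norm_mul, hN', Zsqrtd.norm_intCast] at h3
    have h4 : (p : ℤ) ∣ ((2 * a : ℕ) : ℤ) * ((2 * a : ℕ) : ℤ) := ⟨_, by push_cast; exact h3⟩
    have h5 : p ∣ (2 * a) * (2 * a) := by exact_mod_cast h4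
    have h6 : p ∣ 2 * a := by
      rcases hp.dvd_mul.1 h5 with h | h <;> exact h
    rcases hp.dvd_mul.1 h6 with h | h
    · have := Nat.le_of_dvd (by norm_num) h
      have := hp.two_le
      omega
    · rcases Nat.eq_zero_or_pos a with h0 | h0
      · subst h0
        have h7 : (b ^ 2).Prime := by
          have : b ^ 2 = p := by simpa using hab
          rw [this]; exact hp
        exact Nat.Prime.not_prime_pow le_rfl h7
      · have := Nat.le_of_dvd h0 h
        have hb : b = 0 := by nlinarith [hp.two_le]
        subst hb
        nlinarith [hp.two_le]
  have hunion : gaussSet (p * n) = {z | z ∈ gaussSet (p * n) ∧ P ∣ z} ∪ {z | z ∈ gaussSet (p * n) ∧ star P ∣ z} := by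
    ext z
    simp only [Set.mem_union, Set.mem_ofPred_eq, ← and_or_left, iff_self_and]
    exact dvd_or_star_dvd P p n hP ⟨_, hprod⟩ z
  have hinter : {z | z ∈ gaussSet (p * n) ∧ P ∣ z} ∩ {z | z ∈ gaussSet (p * n) ∧ star P ∣ z} =
      {z | z ∈ gaussSet (p * n) ∧ (p : GaussianInt) ∣ z} := by
    ext z
    simp only [Set.mem_inter_iff, Set.mem_ofPred_eq]
    constructor
    · rintro ⟨⟨h, w, rfl⟩, -, h'⟩
      refine ⟨h, ?_⟩
      rw [hprod]
      exact mul_dvd_mul_left _ ((hP'.dvd_or_dvd h').resolve_left hnd)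
    · rintro ⟨h, h'⟩
      rw [hprod] at h'
      exact ⟨⟨h, (dvd_mul_right _ _).trans h'⟩, h, (dvd_mul_left _ _).trans h'⟩
  have hcount : (if p ∣ n then rr (n / p) else 0) =
      ({z | z ∈ gaussSet (p * n) ∧ (p : GaussianInt) ∣ z} : Set GaussianInt).ncard := by
    have hnp : (p : GaussianInt).norm = ((p * p : ℕ) : ℤ) := by simp [Zsqrtd.norm_def]
    split_ifs with h
    · obtain ⟨m, rfl⟩ := h
      rw [Nat.mul_div_cancel_left _ hp.pos, ← rr_dvd p (p * p) m (by simp [hp.ne_zero]) hnp]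
      simp only [mul_assoc]
    · symm
      rw [Set.ncard_eq_zero ((gaussSet_finite _).subset fun z hz => hz.1), Set.eq_empty_iff_forall_notMem]
      rintro z ⟨hz, w, rfl⟩
      simp only [gaussSet, Set.mem_ofPred_eq, Zsqrtd.norm_mul, hnp] at hz
      apply h
      have h2 : (p : ℤ) * (p * w.norm) = p * n := by push_cast at hz; linarith
      have := mul_left_cancel₀ (by exact_mod_cast hp.ne_zero) h2
      exact_mod_cast (Dvd.intro _ this : (p : ℤ) ∣ n)
  rw [hcount, ← hinter]
  conv_lhs => enter [1]; rw [rr, hunion]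
  rw [Set.ncard_union_add_ncard_inter _ _ ((gaussSet_finite _).subset fun z hz => hz.1)
    ((gaussSet_finite _).subset fun z hz => hz.1), rr_dvd P p n hp.ne_zero hN,
    rr_dvd (star P) p n hp.ne_zero hN']
  ring

lemma rr_one : rr 1 = 4 := by
  have : gaussSet 1 = (({⟨1, 0⟩, ⟨-1, 0⟩, ⟨0, 1⟩, ⟨0, -1⟩} : Finset GaussianInt) : Set GaussianInt) := by
    ext ⟨x, y⟩
    simp only [gaussSet, Set.mem_ofPred_eq, Zsqrtd.norm_def]
    simp only [Finset.coe_insert, Finset.coe_singleton, Set.mem_insert_iff, Set.mem_singleton_iff,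
      Zsqrtd.mk.injEq]
    constructor
    · intro h
      have hx : x ≤ 1 := by push_cast at h; nlinarith [mul_self_nonneg x, mul_self_nonneg y]
      have hx' : -1 ≤ x := by push_cast at h; nlinarith [mul_self_nonneg x, mul_self_nonneg y]
      have hy : y ≤ 1 := by push_cast at h; nlinarith [mul_self_nonneg x, mul_self_nonneg y]
      have hy' : -1 ≤ y := by push_cast at h; nlinarith [mul_self_nonneg x, mul_self_nonneg y]
      push_cast at h
      interval_cases x <;> interval_cases y <;> simp_all
    · rintro (⟨rfl, rfl⟩ | ⟨rfl, rfl⟩ | ⟨rfl, rfl⟩ | ⟨rfl, rfl⟩) <;> norm_num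
  rw [rr, this, Set.ncard_coe_finset]
  decide

def ff (n : ℕ) : ℤ := ∑ d ∈ n.divisors, ZMod.χ₄ (d : ZMod 4)

lemma ff_rel (p n : ℕ) (hp : p.Prime) (hn : n ≠ 0) :
    ff (p * n) + ZMod.χ₄ p * (if p ∣ n then ff (n / p) else 0) = (1 + ZMod.χ₄ p) * ff n := by
  have him : ∀ m : ℕ, ∑ d ∈ m.divisors.image (fun d : ℕ => (p * d : ℕ)), ZMod.χ₄ (d : ZMod 4) = ZMod.χ₄ p * ff m := by
    intro m
    rw [Finset.sum_image (by intro a _ b _ h; exact Nat.eq_of_mul_eq_mul_left hp.pos h), ff, Finset.mul_sum]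
    simp only [Nat.cast_mul, map_mul]
  have hun : (p * n).divisors = n.divisors ∪ n.divisors.image (fun d => p * d) := by
    ext d
    simp only [Nat.mem_divisors, Finset.mem_union, Finset.mem_image]
    constructor
    · rintro ⟨h, h0⟩
      by_cases hd : p ∣ d
      · obtain ⟨e, rfl⟩ := hd
        exact Or.inr ⟨e, ⟨Nat.dvd_of_mul_dvd_mul_left hp.pos h, hn⟩, rfl⟩
      · exact Or.inl ⟨((Nat.Prime.coprime_iff_not_dvd hp).2 hd).symm.dvd_of_dvd_mul_left h, hn⟩
    · rintro (⟨h, -⟩ | ⟨e, ⟨h, -⟩, rfl⟩)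
      · exact ⟨h.mul_left _, mul_ne_zero hp.ne_zero hn⟩
      · exact ⟨mul_dvd_mul_left _ h, mul_ne_zero hp.ne_zero hn⟩
  have hin : ∑ d ∈ n.divisors ∩ n.divisors.image (fun d : ℕ => (p * d : ℕ)), ZMod.χ₄ (d : ZMod 4) =
      ZMod.χ₄ p * (if p ∣ n then ff (n / p) else 0) := by
    split_ifs with h
    · rw [← him]
      congr 1
      obtain ⟨m, rfl⟩ := h
      have hm : m ≠ 0 := by rintro rfl; simp at hn
      rw [Nat.mul_div_cancel_left _ hp.pos]
      ext d
      simp only [Nat.mem_divisors, Finset.mem_inter, Finset.mem_image]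
      constructor
      · rintro ⟨⟨h1, h2⟩, e, ⟨-, -⟩, rfl⟩
        exact ⟨e, ⟨Nat.dvd_of_mul_dvd_mul_left hp.pos h1, hm⟩, rfl⟩
      · rintro ⟨e, ⟨h1, -⟩, rfl⟩
        exact ⟨⟨mul_dvd_mul_left _ h1, hn⟩, e, ⟨h1.mul_left _, hn⟩, rfl⟩
    · rw [mul_zero]
      apply Finset.sum_eq_zero
      intro d hd
      simp only [Nat.mem_divisors, Finset.mem_inter, Finset.mem_image] at hd
      obtain ⟨⟨h1, -⟩, e, -, rfl⟩ := hd
      exact absurd ((dvd_mul_right _ _).trans h1) h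
  rw [← hin, ff, hun, Finset.sum_union_inter, him]
  rw [ff]; ring

lemma rr_eq (n : ℕ) (hn : n ≠ 0) : (rr n : ℤ) = 4 * ff n := by
  induction n using Nat.strong_induction_on with
  | _ n ih =>
    by_cases h1 : n = 1
    · subst h1; simp [rr_one, ff]
    have hp := Nat.minFac_prime h1
    obtain ⟨m, hm⟩ := Nat.minFac_dvd n
    set p := n.minFac
    have hm0 : m ≠ 0 := by rintro rfl; simp at hm; exact hn hm
    have hlt : m < n := by rw [hm]; nlinarith [hp.two_le, Nat.pos_of_ne_zero hm0]
    have hrel := ff_rel p m hp hm0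
    have ihm := ih m hlt hm0
    have ihd : (((if p ∣ m then rr (m / p) else 0 : ℕ)) : ℤ) = 4 * (if p ∣ m then ff (m / p) else 0) := by
      split_ifs with h
      · refine ih _ (lt_of_le_of_lt (Nat.div_le_self _ _) hlt) ?_
        exact (Nat.div_pos (Nat.le_of_dvd (Nat.pos_of_ne_zero hm0) h) hp.pos).ne'
      · simp
    rw [hm]
    rcases hp.eq_two_or_odd with h2 | hodd
    · rw [h2] at hrel ⊢
      rw [rr_two, ihm]
      have : ZMod.χ₄ ((2 : ℕ) : ZMod 4) = 0 := by decide
      rw [this] at hrel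
      linarith
    · have : p % 4 = 1 ∨ p % 4 = 3 := by omega
      rcases this with h | h
      · rw [ZMod.χ₄_nat_one_mod_four h] at hrel
        have := rr_one_mod p m hp h
        have h' : (rr (p * m) : ℤ) + ((if p ∣ m then rr (m / p) else 0 : ℕ) : ℤ) = 2 * rr m := by
          exact_mod_cast this
        rw [ihd, ihm] at h'
        linarith
      · rw [ZMod.χ₄_nat_three_mod_four h] at hrel
        have := rr_three p m hp h
        rw [this, ihd]
        linarith

lemma chi_eq (χ : DirichletCharacter ℂ 4) (hχ : χ ≠ 1) (a : ZMod 4) : χ a = ((ZMod.χ₄ a : ℤ) : ℂ) := by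
  have h0 : χ 0 = 0 := χ.map_nonunit (by decide)
  have h2 : χ 2 = 0 := χ.map_nonunit (by decide)
  have h1 : χ 1 = 1 := map_one χ
  have h3 : χ 3 = -1 := by
    have hsq : χ 3 * χ 3 = 1 := by
      rw [← map_mul, show (3 : ZMod 4) * 3 = 1 by decide, h1]
    rcases mul_self_eq_one_iff.1 hsq with h | h
    · exfalso
      apply hχ
      ext u
      have : (u : ZMod 4) = 1 ∨ (u : ZMod 4) = 3 := by revert u; decide
      rcases this with hu | hu <;> rw [hu]
      · simp
      · rw [h, MulChar.one_apply (by decide)]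
    · exact h
  have : a = 0 ∨ a = 1 ∨ a = 2 ∨ a = 3 := by revert a; decide
  rcases this with rfl | rfl | rfl | rfl
  · rw [h0]; simp
  · rw [h1]; simp
  · rw [h2, show ZMod.χ₄ 2 = 0 by decide]; simp
  · rw [h3, show ZMod.χ₄ 3 = -1 by decide]; simp

lemma zetaMul_eq (χ : DirichletCharacter ℂ 4) (hχ : χ ≠ 1) (n : ℕ) (hn : n ≠ 0) :
    (rr n : ℂ) = 4 * χ.zetaMul n := by
  have h := rr_eq n hn
  have h' : (rr n : ℂ) = 4 * ((ff n : ℤ) : ℂ) := by exact_mod_cast congrArg (Int.cast : ℤ → ℂ) h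
  rw [h', DirichletCharacter.zetaMul, ArithmeticFunction.coe_zeta_mul_apply, ff]
  push_cast
  congr 1
  apply Finset.sum_congr rfl
  intro d hd
  have hd0 : d ≠ 0 := (Nat.pos_of_mem_divisors hd).ne'
  simp [toArithmeticFunction, hd0, chi_eq χ hχ]

lemma LSeries_zetaMul (χ : DirichletCharacter ℂ 4) {s : ℂ} (hs : 1 < s.re) :
    LSeries χ.zetaMul s = riemannZeta s * DirichletCharacter.LFunction χ s := by
  rw [DirichletCharacter.zetaMul, ← ArithmeticFunction.coe_mul, LSeries_convolution']
  · rw [χ.LFunction_eq_LSeries hs]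
    congr 1
    · simp_rw [← ArithmeticFunction.LSeries_zeta_eq_riemannZeta hs, ← ArithmeticFunction.natCoe_apply]
    · exact (LSeries_congr χ.apply_eq_toArithmeticFunction_apply s).symm
  · exact ArithmeticFunction.LSeriesSummable_zeta_iff.mpr hs
  · exact (LSeriesSummable_congr _ fun h ↦ χ.apply_eq_toArithmeticFunction_apply h).mp <|
      ZMod.LSeriesSummable_of_one_lt_re χ hs

/-- The sum over the Gaussian integers by norm. -/
lemma hasSum_gauss (χ : DirichletCharacter ℂ 4) (hχ : χ ≠ 1) (s : ℝ) (hs : 1 < s) :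
    Summable (fun z : GaussianInt => ((z.norm : ℝ)) ^ (-s)) ∧
    (((∑' z : GaussianInt, ((z.norm : ℝ)) ^ (-s) : ℝ)) : ℂ) =
      4 * (riemannZeta s * DirichletCharacter.LFunction χ s) := by
  have hs0 : s ≠ 0 := by linarith
  have hsc : 1 < (s : ℂ).re := by simpa using hs
  have key : ∀ n : ℕ, (((rr n : ℝ) * (n : ℝ) ^ (-s) : ℝ) : ℂ) = 4 * LSeries.term χ.zetaMul s n := by
    intro n
    rcases eq_or_ne n 0 with rfl | hn
    · simp [Real.zero_rpow (neg_ne_zero.2 hs0)]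
    · rw [LSeries.term_of_ne_zero hn, Real.rpow_neg (Nat.cast_nonneg n)]
      push_cast
      rw [zetaMul_eq χ hχ n hn, Complex.ofReal_cpow (Nat.cast_nonneg n)]
      simp only [ofReal_natCast]
      ring
  have hsum : HasSum (fun n : ℕ => (((rr n : ℝ) * (n : ℝ) ^ (-s) : ℝ) : ℂ))
      (4 * (riemannZeta s * DirichletCharacter.LFunction χ s)) := by
    simp_rw [key]
    rw [← LSeries_zetaMul χ hsc]
    exact ((χ.LSeriesSummable_zetaMul hsc).hasSum).mul_left 4
  have hsumR : Summable (fun n : ℕ => ((rr n : ℝ) * (n : ℝ) ^ (-s) : ℝ)) :=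
    Complex.summable_ofReal.1 hsum.summable
  let N : GaussianInt → ℕ := fun z => z.norm.natAbs
  let e := Equiv.sigmaFiberEquiv N
  have hnn : ∀ z : GaussianInt, 0 ≤ ((z.norm : ℝ)) ^ (-s) := fun z =>
    Real.rpow_nonneg (by exact_mod_cast GaussianInt.norm_nonneg z) _
  have hval : ∀ (n : ℕ) (y : {z // N z = n}), (((y : GaussianInt).norm : ℝ)) ^ (-s) = (n : ℝ) ^ (-s) := by
    rintro n ⟨y, rfl⟩
    congr 1
    exact (GaussianInt.natCast_natAbs_norm (α := ℝ) y).symm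
  have hset : ∀ n, {z | N z = n} = gaussSet n := by
    intro n
    ext z
    simp only [N, gaussSet, Set.mem_ofPred_eq]
    have := GaussianInt.abs_natCast_norm z
    omega
  have hfin : ∀ n, Finite {z // N z = n} := fun n => by
    have := gaussSet_finite n
    rw [← hset] at this
    exact this
  have hcard : ∀ n, Nat.card {z // N z = n} = rr n := fun n => by
    rw [rr, ← hset, ← Nat.card_coe_set_eq]; rfl
  have hfib : ∀ n, ∑' y : {z // N z = n}, (((e ⟨n, y⟩ : GaussianInt).norm : ℝ)) ^ (-s) =
      rr n * (n : ℝ) ^ (-s) := by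
    intro n
    have := hfin n
    have : ∀ y : {z // N z = n}, (((e ⟨n, y⟩ : GaussianInt).norm : ℝ)) ^ (-s) = (n : ℝ) ^ (-s) := hval n
    simp_rw [this]
    rw [tsum_const, hcard]; simp
  have hS : Summable (fun x => (((e x : GaussianInt).norm : ℝ)) ^ (-s)) := by
    rw [summable_sigma_of_nonneg (fun x => hnn _)]
    refine ⟨fun n => ?_, ?_⟩
    · have := hfin n
      exact Summable.of_finite
    · simp_rw [hfib]; exact hsumR
  refine ⟨e.summable_iff.1 hS, ?_⟩
  rw [← e.tsum_eq, hS.tsum_sigma]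
  simp_rw [hfib]
  rw [Complex.ofReal_tsum]
  exact hsum.tsum_eq

lemma tsum_even (f : ℤ → ℝ) (hf : Summable f) (he : ∀ n, f (-n) = f n) :
    ∑' n, f n = f 0 + 2 * ∑' n : ℕ, f (n + 1) := by
  have h1 : Summable (fun n : ℕ => f n) := hf.comp_injective Nat.cast_injective
  have h2 : Summable (fun n : ℕ => f (n + 1)) := by
    have := (summable_nat_add_iff 1).2 h1
    simpa using this
  have h3 := h1.hasSum.of_nat_of_neg_add_one (f := f) (m' := ∑' n : ℕ, f (n + 1)) (by
    simp_rw [he]; exact h2.hasSum)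
  rw [h3.tsum_eq, h1.tsum_eq_zero_add]
  push_cast
  ring

/-- Row sums. -/
noncomputable def gg (s : ℝ) (m : ℕ) : ℝ := ∑' n : ℤ, ((m : ℝ) ^ 2 + (n : ℝ) ^ 2) ^ (-s)

def gaussEquiv : ℤ × ℤ ≃ GaussianInt where
  toFun p := ⟨p.1, p.2⟩
  invFun z := (z.re, z.im)
  left_inv _ := rfl
  right_inv _ := rfl

lemma main_id (χ : DirichletCharacter ℂ 4) (hχ : χ ≠ 1) (s : ℝ) (hs : 1 < s) :
    Summable (fun m : ℕ => gg s (m + 1)) ∧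
    4 * (riemannZeta s * DirichletCharacter.LFunction χ s) =
      2 * riemannZeta (2 * s) + 2 * ((∑' m : ℕ, gg s (m + 1) : ℝ) : ℂ) := by
  obtain ⟨h1, h2⟩ := hasSum_gauss χ hχ s hs
  rw [← h2]
  have hF : (fun p : ℤ × ℤ => (((gaussEquiv p).norm : ℝ)) ^ (-s)) =
      fun p : ℤ × ℤ => ((p.1 : ℝ) ^ 2 + (p.2 : ℝ) ^ 2) ^ (-s) := by
    ext p
    simp only [gaussEquiv, Equiv.coe_fn_mk, Zsqrtd.norm_def]
    push_cast
    congr 1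
    ring
  have hS : Summable (fun p : ℤ × ℤ => ((p.1 : ℝ) ^ 2 + (p.2 : ℝ) ^ 2) ^ (-s)) := by
    rw [← hF]; exact gaussEquiv.summable_iff.2 h1
  rw [← gaussEquiv.tsum_eq, hF, hS.tsum_prod]
  have hrow : Summable (fun m : ℤ => ∑' n : ℤ, ((m : ℝ) ^ 2 + (n : ℝ) ^ 2) ^ (-s)) := hS.prod
  rw [tsum_even _ hrow (by intro n; simp)]
  have hrow' : Summable (fun m : ℕ => gg s (m + 1)) := by
    have h3 : Summable (fun n : ℕ => _) := hrow.comp_injective (i := fun n : ℕ => ((n + 1 : ℕ) : ℤ))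
      (fun a b h => by simpa using h)
    refine h3.congr fun n => ?_
    simp [gg]
  refine ⟨hrow', ?_⟩
  have h0 : Summable (fun n : ℤ => (((0 : ℤ) : ℝ) ^ 2 + (n : ℝ) ^ 2) ^ (-s)) :=
    hS.prod_factor 0
  rw [tsum_even _ h0 (by intro n; simp)]
  have hz : ((∑' n : ℕ, ((((0 : ℤ) : ℝ)) ^ 2 + (((n : ℤ) + 1 : ℤ) : ℝ) ^ 2) ^ (-s) : ℝ) : ℂ) = riemannZeta (2 * s) := by
    rw [zeta_eq_tsum_one_div_nat_add_one_cpow (by simp; linarith), Complex.ofReal_tsum]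
    congr 1
    ext n
    have hn : (0 : ℝ) ≤ n + 1 := by positivity
    have : ((((0 : ℤ) : ℝ)) ^ 2 + (((n : ℤ) + 1 : ℤ) : ℝ) ^ 2) ^ (-s) = 1 / ((n : ℝ) + 1) ^ (2 * s) := by
      push_cast
      rw [zero_pow two_ne_zero, zero_add, ← Real.rpow_natCast, ← Real.rpow_mul hn, one_div, ← Real.rpow_neg hn]
      congr 1; push_cast; ring
    rw [this]
    push_cast
    rw [Complex.ofReal_cpow hn]
    push_cast
    rfl
  have hzero : ((((0 : ℤ) : ℝ)) ^ 2 + (((0 : ℤ)) : ℝ) ^ 2) ^ (-s) = 0 := by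
    simp [Real.zero_rpow (neg_ne_zero.2 (by linarith : s ≠ 0))]
  have hgg : (∑' m : ℕ, gg s (m + 1)) = ∑' m : ℕ, ∑' n : ℤ, ((((m : ℤ) + 1 : ℤ) : ℝ) ^ 2 + (n : ℝ) ^ 2) ^ (-s) := by
    refine tsum_congr fun m => ?_
    simp [gg]
  rw [hzero, hgg, ← hz]
  push_cast
  ring

lemma abs_helper {a S I b : ℝ} (h1 : S ≤ I) (h2 : I ≤ a + S) (h0 : a ≤ b) :
    |a + 2 * S - 2 * I| ≤ b := by
  rw [abs_le]
  constructor <;> linarith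

open MeasureTheory Set in
lemma integrable_base (s : ℝ) (hs : 1 ≤ s) (a : ℝ) (ha : 1 ≤ a) :
    Integrable (fun x : ℝ => (a ^ 2 + x ^ 2) ^ (-s)) := by
  refine integrable_inv_one_add_sq.mono' ?_ ?_
  · exact (by fun_prop : Measurable fun x : ℝ => (a ^ 2 + x ^ 2) ^ (-s)).aestronglyMeasurable
  · refine Filter.Eventually.of_forall fun x => ?_
    have h1 : 1 + x ^ 2 ≤ a ^ 2 + x ^ 2 := by nlinarith
    have h2 : 1 ≤ a ^ 2 + x ^ 2 := by nlinarith [sq_nonneg x]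
    have h3 : (0 : ℝ) < 1 + x ^ 2 := by positivity
    rw [Real.norm_of_nonneg (by positivity)]
    calc (a ^ 2 + x ^ 2) ^ (-s) ≤ (a ^ 2 + x ^ 2) ^ (-1 : ℝ) :=
          Real.rpow_le_rpow_of_exponent_le h2 (by linarith)
      _ = (a ^ 2 + x ^ 2)⁻¹ := Real.rpow_neg_one _
      _ ≤ (1 + x ^ 2)⁻¹ := by gcongr

noncomputable def BB (s : ℝ) : ℝ := ∫ x : ℝ, (1 + x ^ 2) ^ (-s)

open MeasureTheory Set in
lemma anti_base (s : ℝ) (hs : 1 ≤ s) (a : ℝ) (ha : 1 ≤ a) :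
    AntitoneOn (fun x : ℝ => (a ^ 2 + x ^ 2) ^ (-s)) (Ici 0) := by
  intro x hx y hy hxy
  have hx' : (0 : ℝ) ≤ x := hx
  have : a ^ 2 + x ^ 2 ≤ a ^ 2 + y ^ 2 := by nlinarith
  exact Real.rpow_le_rpow_of_nonpos (by positivity) this (by linarith)

open MeasureTheory Set in
lemma half_integral (s : ℝ) (a : ℝ) (ha : 1 ≤ a) :
    2 * ∫ x in Ioi (0 : ℝ), (a ^ 2 + x ^ 2) ^ (-s) = a ^ (1 - 2 * s) * BB s := by
  have ha0 : 0 < a := by linarith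
  have h1 : BB s = 2 * ∫ x in Ioi (0 : ℝ), (1 + x ^ 2) ^ (-s) := by
    rw [BB, ← integral_comp_abs (f := fun x : ℝ => (1 + x ^ 2) ^ (-s))]
    simp
  have h2 := integral_comp_mul_left_Ioi (fun x : ℝ => (a ^ 2 + x ^ 2) ^ (-s)) 0 ha0
  have h3 : ∀ x : ℝ, (a ^ 2 + (a * x) ^ 2) ^ (-s) = a ^ (- (2 * s)) * (1 + x ^ 2) ^ (-s) := by
    intro x
    rw [show a ^ 2 + (a * x) ^ 2 = a ^ 2 * (1 + x ^ 2) by ring,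
      Real.mul_rpow (by positivity) (by positivity), ← Real.rpow_natCast, ← Real.rpow_mul ha0.le]
    congr 2; push_cast; ring
  simp_rw [h3] at h2
  rw [integral_const_mul, mul_zero, smul_eq_mul] at h2
  rw [h1, show 1 - 2 * s = 1 + (-(2 * s)) by ring, Real.rpow_add ha0, Real.rpow_one]
  have : ∫ x in Ioi (0 : ℝ), (a ^ 2 + x ^ 2) ^ (-s) =
      a * (a⁻¹ * ∫ x in Ioi (0 : ℝ), (a ^ 2 + x ^ 2) ^ (-s)) := by field_simp
  rw [this, ← h2]; ring

open MeasureTheory Set in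
lemma summable_row (s : ℝ) (hs : 1 ≤ s) (m : ℕ) (hm : 1 ≤ m) :
    Summable (fun n : ℤ => ((m : ℝ) ^ 2 + (n : ℝ) ^ 2) ^ (-s)) := by
  have ha : (1 : ℝ) ≤ m := by exact_mod_cast hm
  have h := (anti_base s hs m ha).summable_of_integrableOn_Ioi_zero
    (integrable_base s hs m ha).integrableOn (fun t _ => by positivity)
  refine Summable.of_nat_of_neg ?_ ?_
  · exact_mod_cast h
  · simpa using h

open MeasureTheory Set in
lemma gg_bound (s : ℝ) (hs : 1 ≤ s) (m : ℕ) (hm : 1 ≤ m) :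
    |gg s m - (m : ℝ) ^ (1 - 2 * s) * BB s| ≤ 1 / (m : ℝ) ^ 2 := by
  have ha : (1 : ℝ) ≤ m := by exact_mod_cast hm
  have hanti := anti_base s hs m ha
  have hint := (integrable_base s hs m ha).integrableOn (s := Ioi 0)
  have hnn : ∀ t ∈ Ioi (0 : ℝ), 0 ≤ ((m : ℝ) ^ 2 + t ^ 2) ^ (-s) := fun t _ => by positivity
  have hsum := hanti.summable_of_integrableOn_Ioi_zero hint hnn
  have h1 := hanti.tsum_add_one_le_integral hint hnn
  have h2 := hanti.integral_le_tsum hsum hnn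
  rw [hsum.tsum_eq_zero_add] at h2
  rw [gg, tsum_even _ (summable_row s hs m hm) (by intro n; simp), ← half_integral s m ha]
  have h0 : ((m : ℝ) ^ 2 + ((0 : ℕ) : ℝ) ^ 2) ^ (-s) ≤ 1 / (m : ℝ) ^ 2 := by
    have : (1 : ℝ) ≤ (m : ℝ) ^ 2 := by nlinarith
    simp only [Nat.cast_zero, ne_eq, OfNat.ofNat_ne_zero, not_false_eq_true, zero_pow, add_zero]
    calc ((m : ℝ) ^ 2) ^ (-s) ≤ ((m : ℝ) ^ 2) ^ (-1 : ℝ) :=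
          Real.rpow_le_rpow_of_exponent_le this (by linarith)
      _ = _ := by rw [Real.rpow_neg_one, one_div]
  push_cast at h1 h2 h0 ⊢
  exact abs_helper h1 h2 h0

open MeasureTheory Set in
lemma BB_eq (s : ℝ) (hs : 1 ≤ s) : BB s = √π * Real.Gamma (s - 1 / 2) / Real.Gamma s := by
  have hs0 : 0 < s := by linarith
  have hG : 0 < Real.Gamma s := Real.Gamma_pos_of_pos hs0
  rw [eq_div_iff hG.ne', BB, ← integral_mul_const]
  let F : ℝ → ℝ → ℝ := fun x t => t ^ (s - 1) * Real.exp (-((1 + x ^ 2) * t))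
  have hin : ∀ x : ℝ, ∫ t in Ioi (0 : ℝ), F x t = (1 + x ^ 2) ^ (-s) * Real.Gamma s := by
    intro x
    rw [Real.integral_rpow_mul_exp_neg_mul_Ioi hs0 (by positivity), one_div,
      Real.inv_rpow (by positivity), Real.rpow_neg (by positivity)]
  have hFint : Integrable (Function.uncurry F) (volume.prod (volume.restrict (Ioi (0 : ℝ)))) := by
    have hmeas : AEStronglyMeasurable (Function.uncurry F) (volume.prod (volume.restrict (Ioi (0 : ℝ)))) := by
      refine Measurable.aestronglyMeasurable ?_
      simp only [F, Function.uncurry_def]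
      fun_prop
    rw [integrable_prod_iff hmeas]
    constructor
    · refine Filter.Eventually.of_forall fun x => ?_
      by_contra hcon
      have h0 := integral_undef hcon
      have := hin x
      simp only [Function.uncurry] at h0
      rw [h0] at this
      have h2 : 0 < (1 + x ^ 2) ^ (-s) * Real.Gamma s := by positivity
      linarith
    · have : (fun x => ∫ y in Ioi (0 : ℝ), ‖Function.uncurry F (x, y)‖) =
          fun x => (1 + x ^ 2) ^ (-s) * Real.Gamma s := by
        ext x
        rw [← hin x]
        refine setIntegral_congr_fun measurableSet_Ioi fun t ht => ?_
        have ht' : (0 : ℝ) < t := ht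
        simp only [Function.uncurry, F]
        rw [Real.norm_of_nonneg (by positivity)]
      rw [this]
      have := (integrable_base s hs 1 le_rfl).mul_const (Real.Gamma s)
      simpa using this
  calc ∫ x : ℝ, (1 + x ^ 2) ^ (-s) * Real.Gamma s = ∫ x : ℝ, ∫ t in Ioi (0 : ℝ), F x t := by
        simp_rw [hin]
    _ = ∫ t in Ioi (0 : ℝ), ∫ x : ℝ, F x t := integral_integral_swap hFint
    _ = ∫ t in Ioi (0 : ℝ), √π * (t ^ ((s - 1 / 2) - 1) * Real.exp (-(1 * t))) := by
        refine setIntegral_congr_fun measurableSet_Ioi fun t ht => ?_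
        have ht' : (0 : ℝ) < t := ht
        have hF : ∀ x, F x t = (t ^ (s - 1) * Real.exp (-t)) * Real.exp (-t * x ^ 2) := by
          intro x
          simp only [F]
          rw [mul_assoc, ← Real.exp_add]
          congr 2; ring
        simp_rw [hF]
        rw [integral_const_mul, integral_gaussian, Real.sqrt_div pi_pos.le, Real.sqrt_eq_rpow t,
          show s - 1 / 2 - 1 = (s - 1) - 1 / 2 by ring, Real.rpow_sub ht' (s - 1) (1 / 2), one_mul]
        ring
    _ = √π * Real.Gamma (s - 1 / 2) := by
        rw [integral_const_mul, Real.integral_rpow_mul_exp_neg_mul_Ioi (by linarith) one_pos]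
        simp

lemma BB_one : BB 1 = π := by
  rw [BB, ← integral_univ_inv_one_add_sq]
  simp_rw [Real.rpow_neg_one]

lemma hasDerivAt_BB' :
    HasDerivAt (fun s : ℝ => √π * Real.Gamma (s - 1 / 2) / Real.Gamma s) (-2 * π * Real.log 2) 1 := by
  have h1 : HasDerivAt Real.Gamma (-√π * (Real.eulerMascheroniConstant + 2 * Real.log 2)) (1 - 1 / 2) := by
    convert! Real.hasDerivAt_Gamma_one_half using 1; norm_num
  have h2 := h1.comp_sub_const (1 : ℝ) (1 / 2)
  have h3 := (h2.const_mul √π).div Real.hasDerivAt_Gamma_one (by simp)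
  convert! h3 using 1
  have h4 : Real.Gamma (1 - 1 / 2) = √π := by
    rw [← Real.Gamma_one_half_eq]; norm_num
  have h5 : √π * √π = π := Real.mul_self_sqrt pi_pos.le
  rw [h4, Real.Gamma_one]
  linear_combination (2 * Real.log 2) * (-1) * h5 * (-1)

open Filter Topology in
lemma gg_tendsto (m : ℕ) (hm : 1 ≤ m) :
    Tendsto (fun s : ℝ => gg s m) (𝓝[>] 1) (𝓝 (gg 1 m)) := by
  have ha : (1 : ℝ) ≤ m := by exact_mod_cast hm
  unfold gg
  refine tendsto_tsum_of_dominated_convergence (summable_row 1 le_rfl m hm) ?_ ?_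
  · intro n
    have hpos : (0 : ℝ) < (m : ℝ) ^ 2 + (n : ℝ) ^ 2 := by positivity
    have : Continuous (fun s : ℝ => ((m : ℝ) ^ 2 + (n : ℝ) ^ 2) ^ (-s)) :=
      Continuous.rpow continuous_const continuous_neg (fun _ => Or.inl hpos.ne')
    exact (this.tendsto 1).mono_left nhdsWithin_le_nhds
  · filter_upwards [self_mem_nhdsWithin] with s hs n
    have hs' : 1 < s := hs
    rw [Real.norm_of_nonneg (by positivity)]
    exact Real.rpow_le_rpow_of_exponent_le (by nlinarith [sq_nonneg (n : ℝ)]) (by linarith)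

lemma gg_one (m : ℕ) (hm : 1 ≤ m) :
    gg 1 m = π / m + 2 * π * (1 / (m * (Real.exp (2 * π * m) - 1))) := by
  have hm0 : (m : ℝ) ≠ 0 := by positivity
  have hm0' : (m : ℂ) ≠ 0 := by exact_mod_cast hm0
  have hx : ((m : ℂ) * I) ∈ Complex.integerComplement := by
    rintro ⟨k, hk⟩
    have := congrArg Complex.im hk
    simp at this
    exact hm0 (by exact_mod_cast this.symm)
  have hc := cot_series_rep' hx
  rw [Complex.cot_pi_eq_exp_ratio] at hc
  have hterm : ∀ n : ℕ, (1 / ((m : ℂ) * I - (n + 1)) + 1 / ((m : ℂ) * I + (n + 1))) =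
      (-2 * m * I) * ((((m : ℝ) ^ 2 + (((n : ℤ) + 1 : ℤ) : ℝ) ^ 2) ^ (-1 : ℝ) : ℝ) : ℂ) := by
    intro n
    rw [Real.rpow_neg_one]
    push_cast
    have hI := Complex.I_sq
    have e1 : (m : ℂ) * I - (n + 1) ≠ 0 := by
      intro h
      have := congrArg Complex.im h
      simp at this; omega
    have e2 : (m : ℂ) * I + (n + 1) ≠ 0 := by
      intro h
      have := congrArg Complex.im h
      simp at this; omega
    have e3 : (m : ℂ) ^ 2 + ((n : ℂ) + 1) ^ 2 ≠ 0 := by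
      have : (0 : ℝ) < (m : ℝ) ^ 2 + ((n : ℝ) + 1) ^ 2 := by positivity
      exact_mod_cast this.ne'
    field_simp
    linear_combination (-2 * (m : ℂ) ^ 3 * I) * hI * (-1)
  simp_rw [hterm] at hc
  rw [tsum_mul_left, ← Complex.ofReal_tsum] at hc
  rw [gg, tsum_even _ (summable_row 1 le_rfl m hm) (by intro n; simp)]
  set T := ∑' n : ℕ, ((m : ℝ) ^ 2 + (((n : ℤ) + 1 : ℤ) : ℝ) ^ 2) ^ (-1 : ℝ) with hT
  have hexp : Complex.exp (2 * π * I * (m * I)) = (((Real.exp (2 * π * m))⁻¹ : ℝ) : ℂ) := by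
    rw [← Real.exp_neg]
    push_cast
    congr 1
    linear_combination (2 * (π : ℂ) * m) * Complex.I_sq
  rw [hexp] at hc
  set E := Real.exp (2 * π * m) with hE
  have hE1 : 1 < E := by rw [hE]; exact Real.one_lt_exp_iff.2 (by positivity)
  have hreal : π * ((E⁻¹ + 1) / (1 - E⁻¹)) - 1 / m = 2 * m * T := by
    have h1 : (1 - E⁻¹) ≠ 0 := by
      have := inv_lt_one_of_one_lt₀ hE1
      linarith
    have h1' : (1 - (E : ℂ)⁻¹) ≠ 0 := by exact_mod_cast h1
    have hcc : ((π * ((E⁻¹ + 1) / (1 - E⁻¹)) - 1 / m : ℝ) : ℂ) = ((2 * m * T : ℝ) : ℂ) := by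
      push_cast at hc ⊢
      have hI := Complex.I_ne_zero
      have e : (π : ℂ) * (((E : ℂ)⁻¹ + 1) / (1 - (E : ℂ)⁻¹)) - 1 / m =
        I * (π * (((E : ℂ)⁻¹ + 1) / (I * (1 - (E : ℂ)⁻¹))) - 1 / (m * I)) := by
        field_simp
      rw [e, hc]
      linear_combination (-2 * (m : ℂ) * T) * Complex.I_sq
    exact_mod_cast hcc
  have hE0 : E ≠ 0 := by linarith
  have hE2 : E - 1 ≠ 0 := by linarith
  have hT2 : T = (π * ((E⁻¹ + 1) / (1 - E⁻¹)) - 1 / m) / (2 * m) := by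
    rw [hreal]; field_simp
  rw [hT2, Real.rpow_neg_one]
  have h3 : (E⁻¹ + 1) / (1 - E⁻¹) = 1 + 2 / (E - 1) := by
    have h1 : (1 - E⁻¹) ≠ 0 := by
      have := inv_lt_one_of_one_lt₀ hE1
      linarith
    rw [div_eq_iff h1]
    field_simp
    ring
  rw [h3]
  push_cast
  field_simp
  ring

noncomputable def EE (s : ℝ) (m : ℕ) : ℝ := gg s (m + 1) - ((m : ℝ) + 1) ^ (1 - 2 * s) * BB s

lemma EE_bound (s : ℝ) (hs : 1 ≤ s) (m : ℕ) : |EE s m| ≤ 1 / ((m : ℝ) + 1) ^ 2 := by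
  have := gg_bound s hs (m + 1) (by omega)
  push_cast at this
  exact this

lemma summable_bound : Summable (fun m : ℕ => 1 / ((m : ℝ) + 1) ^ 2) := by
  have := (summable_nat_add_iff 1).2 (Real.summable_one_div_nat_pow.2 (by norm_num : 1 < 2))
  exact_mod_cast this

open Filter Topology in
lemma BB_hasDeriv : Tendsto (fun s : ℝ => (BB s - π) / (s - 1)) (𝓝[>] 1) (𝓝 (-2 * π * Real.log 2)) := by
  have h := hasDerivAt_BB'.tendsto_slope.mono_left
    (nhdsWithin_mono 1 (fun x (hx : 1 < x) => hx.ne') : 𝓝[>] (1 : ℝ) ≤ 𝓝[≠] 1)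
  refine h.congr' ?_
  filter_upwards [self_mem_nhdsWithin] with s hs
  have hs' : 1 < s := hs
  rw [slope_def_field, ← BB_eq s hs'.le, ← BB_eq 1 le_rfl, BB_one]

open Filter Topology in
lemma BB_tendsto : Tendsto BB (𝓝[>] 1) (𝓝 π) := by
  have h := (hasDerivAt_BB'.continuousAt.tendsto).mono_left
    (nhdsWithin_le_nhds : 𝓝[>] (1 : ℝ) ≤ 𝓝 1)
  rw [← BB_eq 1 le_rfl, BB_one] at h
  refine h.congr' ?_
  filter_upwards [self_mem_nhdsWithin] with s hs
  have hs' : 1 < s := hs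
  rw [← BB_eq s hs'.le]

lemma EE_one (m : ℕ) : EE 1 m = 2 * π * (1 / ((m + 1) * (Real.exp (2 * π * (m + 1)) - 1))) := by
  rw [EE, gg_one (m + 1) (by omega), BB_one, show (1 : ℝ) - 2 * 1 = -1 by norm_num, Real.rpow_neg_one]
  push_cast
  ring

open Filter Topology in
lemma EE_tendsto : Tendsto (fun s => ∑' m, EE s m) (𝓝[>] 1)
    (𝓝 (2 * π * ∑' m : ℕ, 1 / (((m : ℝ) + 1) * (Real.exp (2 * π * (m + 1)) - 1)))) := by
  rw [← tsum_mul_left]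
  simp_rw [← EE_one]
  refine tendsto_tsum_of_dominated_convergence summable_bound ?_ ?_
  · intro m
    unfold EE
    refine (gg_tendsto (m + 1) (by omega)).sub (Tendsto.mul ?_ (by rw [BB_one]; exact BB_tendsto))
    have hpos : (0 : ℝ) < (m : ℝ) + 1 := by positivity
    have : Continuous (fun s : ℝ => ((m : ℝ) + 1) ^ (1 - 2 * s)) :=
      Continuous.rpow continuous_const (by fun_prop) (fun _ => Or.inl hpos.ne')
    exact (this.tendsto 1).mono_left nhdsWithin_le_nhds
  · filter_upwards [self_mem_nhdsWithin] with s hs m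
    exact EE_bound s (le_of_lt hs) m

lemma main_id2 (χ : DirichletCharacter ℂ 4) (hχ : χ ≠ 1) (s : ℝ) (hs : 1 < s) :
    4 * (riemannZeta s * DirichletCharacter.LFunction χ s) =
      2 * riemannZeta (2 * s) + 2 * (riemannZeta (2 * s - 1) * BB s + ((∑' m : ℕ, EE s m : ℝ) : ℂ)) := by
  obtain ⟨h1, h2⟩ := main_id χ hχ s hs
  have hE : Summable (fun m => EE s m) :=
    Summable.of_norm_bounded summable_bound (fun m => by rw [Real.norm_eq_abs]; exact EE_bound s hs.le m)
  have hP : Summable (fun m : ℕ => ((m : ℝ) + 1) ^ (1 - 2 * s)) := by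
    have := (summable_nat_add_iff 1).2 (Real.summable_nat_rpow.2 (by linarith : 1 - 2 * s < -1))
    exact_mod_cast this
  have hz : ((∑' m : ℕ, ((m : ℝ) + 1) ^ (1 - 2 * s) : ℝ) : ℂ) = riemannZeta (2 * s - 1) := by
    rw [zeta_eq_tsum_one_div_nat_add_one_cpow (by simp; linarith), Complex.ofReal_tsum]
    refine tsum_congr fun n => ?_
    have hn : (0 : ℝ) ≤ n + 1 := by positivity
    rw [show 1 - 2 * s = -(2 * s - 1) by ring, Real.rpow_neg hn]
    push_cast
    rw [Complex.ofReal_cpow hn]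
    push_cast
    rw [one_div]
  have hsplit : ∑' m : ℕ, gg s (m + 1) = (∑' m : ℕ, ((m : ℝ) + 1) ^ (1 - 2 * s)) * BB s + ∑' m, EE s m := by
    rw [← tsum_mul_right, ← (hP.mul_right _).tsum_add hE]
    refine tsum_congr fun m => ?_
    rw [EE]; ring
  rw [h2, hsplit, ← hz]
  push_cast
  ring

open Filter Topology in
theorem stmt5 (χ : DirichletCharacter ℂ 4) (hχ : χ ≠ 1) :
    deriv (fun s : ℂ => (4 : ℂ) ^ s * DirichletCharacter.LFunction χ s) 1 =
      ((π ^ 2 / 3 + π * Real.eulerMascheroniConstant +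
        4 * π * ∑' ℓ : ℕ, 1 / ((ℓ + 1) * (Real.exp (2 * π * (ℓ + 1)) - 1)) : ℝ) : ℂ) := by
  set S : ℝ := ∑' ℓ : ℕ, 1 / (((ℓ : ℝ) + 1) * (Real.exp (2 * π * (ℓ + 1)) - 1)) with hS
  set L := DirichletCharacter.LFunction χ with hL
  set γ := Real.eulerMascheroniConstant
  have hLd : HasDerivAt L (deriv L 1) 1 :=
    ((DirichletCharacter.differentiable_LFunction hχ) 1).hasDerivAt
  have hcast : Tendsto (fun s : ℝ => (s : ℂ)) (𝓝[>] 1) (𝓝[≠] 1) := by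
    refine tendsto_nhdsWithin_iff.2 ⟨?_, ?_⟩
    · exact (Complex.continuous_ofReal.tendsto' 1 1 (by simp)).mono_left nhdsWithin_le_nhds
    · filter_upwards [self_mem_nhdsWithin] with s hs
      have hs' : 1 < s := hs
      simp only [Set.mem_compl_iff, Set.mem_singleton_iff]
      exact_mod_cast hs'.ne'
  have hLslope : Tendsto (fun s : ℝ => (L s - L 1) / ((s : ℂ) - 1)) (𝓝[>] 1) (𝓝 (deriv L 1)) := by
    refine (hLd.tendsto_slope.comp hcast).congr fun s => ?_
    simp [slope_def_field]
  have hLt : Tendsto (fun s : ℝ => L s) (𝓝[>] 1) (𝓝 (L 1)) :=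
    hLd.continuousAt.tendsto.comp (hcast.mono_right nhdsWithin_le_nhds)
  have hZ1 : Tendsto (fun s : ℝ => riemannZeta s - 1 / ((s : ℂ) - 1)) (𝓝[>] 1) (𝓝 (γ : ℂ)) := by
    exact tendsto_riemannZeta_sub_one_div.comp hcast
  have hdbl : Tendsto (fun s : ℝ => 2 * s - 1) (𝓝[>] 1) (𝓝[>] 1) := by
    refine tendsto_nhdsWithin_iff.2 ⟨?_, ?_⟩
    · exact ((by fun_prop : Continuous fun s : ℝ => 2 * s - 1).tendsto' 1 1 (by norm_num)).mono_left
        nhdsWithin_le_nhds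
    · filter_upwards [self_mem_nhdsWithin] with s hs
      have hs' : 1 < s := hs
      simp only [Set.mem_Ioi]
      linarith
  have hZ2 : Tendsto (fun s : ℝ => riemannZeta (2 * s - 1) - 1 / (2 * ((s : ℂ) - 1))) (𝓝[>] 1) (𝓝 (γ : ℂ)) := by
    refine (hZ1.comp hdbl).congr fun s => ?_
    simp only [Function.comp]
    push_cast
    congr 2
    ring
  have hZ3 : Tendsto (fun s : ℝ => riemannZeta (2 * s)) (𝓝[>] 1) (𝓝 ((π : ℂ) ^ 2 / 6)) := by
    have h1 : ContinuousAt riemannZeta 2 := (differentiableAt_riemannZeta (by norm_num)).continuousAt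
    rw [← riemannZeta_two]
    refine h1.tendsto.comp ?_
    exact ((by fun_prop : Continuous fun s : ℝ => (2 * s : ℂ)).tendsto' 1 2 (by norm_num)).mono_left
        nhdsWithin_le_nhds
  have hB : Tendsto (fun s : ℝ => (BB s : ℂ)) (𝓝[>] 1) (𝓝 (π : ℂ)) :=
    (Complex.continuous_ofReal.tendsto π).comp BB_tendsto
  have hBs : Tendsto (fun s : ℝ => ((BB s : ℂ) - π) / ((s : ℂ) - 1)) (𝓝[>] 1)
      (𝓝 ((-2 * π * Real.log 2 : ℝ) : ℂ)) := by
    refine ((Complex.continuous_ofReal.tendsto _).comp BB_hasDeriv).congr fun s => ?_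
    simp
  have hE : Tendsto (fun s : ℝ => ((∑' m, EE s m : ℝ) : ℂ)) (𝓝[>] 1) (𝓝 ((2 * π * S : ℝ) : ℂ)) :=
    (Complex.continuous_ofReal.tendsto _).comp EE_tendsto
  -- the right-hand side
  have hR : Tendsto (fun s : ℝ => 2 * riemannZeta (2 * s) + 2 * ((∑' m, EE s m : ℝ) : ℂ)
      - 4 * L s * (riemannZeta s - 1 / ((s : ℂ) - 1))
      + 2 * (BB s : ℂ) * (riemannZeta (2 * s - 1) - 1 / (2 * ((s : ℂ) - 1)))) (𝓝[>] 1)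
      (𝓝 (2 * ((π : ℂ) ^ 2 / 6) + 2 * ((2 * π * S : ℝ) : ℂ) - 4 * L 1 * γ + 2 * π * γ)) :=
    (((hZ3.const_mul 2).add (hE.const_mul 2)).sub ((hLt.const_mul 4).mul hZ1)).add
      ((hB.const_mul 2).mul hZ2)
  have hQ : Tendsto (fun s : ℝ => (4 * L s - BB s) / ((s : ℂ) - 1)) (𝓝[>] 1)
      (𝓝 (2 * ((π : ℂ) ^ 2 / 6) + 2 * ((2 * π * S : ℝ) : ℂ) - 4 * L 1 * γ + 2 * π * γ)) := by
    refine hR.congr' ?_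
    filter_upwards [self_mem_nhdsWithin] with s hs
    have hs' : 1 < s := hs
    have hne : (s : ℂ) - 1 ≠ 0 := by
      rw [sub_ne_zero]; exact_mod_cast hs'.ne'
    have hid := main_id2 χ hχ s hs'
    have e1 : 1 / (2 * ((s : ℂ) - 1)) = (1 / 2) * (1 / ((s : ℂ) - 1)) := by field_simp
    rw [div_eq_mul_one_div (4 * L s - BB s), e1]
    linear_combination (-1) * hid
  have hsub : Tendsto (fun s : ℝ => (s : ℂ) - 1) (𝓝[>] 1) (𝓝 0) := by
    have := (hcast.mono_right nhdsWithin_le_nhds).sub_const (1 : ℂ)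
    simpa using this
  have hL1 : 4 * L 1 = π := by
    have h1 := (hQ.mul hsub)
    rw [mul_zero] at h1
    have h2 : Tendsto (fun s : ℝ => (4 * L s - BB s)) (𝓝[>] 1) (𝓝 (4 * L 1 - π)) :=
      (hLt.const_mul 4).sub hB
    have h3 := tendsto_nhds_unique_of_eventuallyEq h1 h2 (by
      filter_upwards [self_mem_nhdsWithin] with s hs
      have hs' : 1 < s := hs
      have hne : (s : ℂ) - 1 ≠ 0 := by
        rw [sub_ne_zero]; exact_mod_cast hs'.ne'
      field_simp)
    exact (sub_eq_zero.1 h3.symm)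
  have hQ2 : Tendsto (fun s : ℝ => (4 * L s - BB s) / ((s : ℂ) - 1)) (𝓝[>] 1)
      (𝓝 (4 * deriv L 1 - ((-2 * π * Real.log 2 : ℝ) : ℂ))) := by
    refine ((hLslope.const_mul 4).sub hBs).congr fun s => ?_
    rw [← hL1]; ring
  have hfin := tendsto_nhds_unique hQ2 hQ
  have hpow : HasDerivAt (fun s : ℂ => (4 : ℂ) ^ s) ((4 : ℂ) ^ (1 : ℂ) * Complex.log 4) 1 := by
    have := (hasDerivAt_id (1 : ℂ)).const_cpow (c := 4) (Or.inl (by norm_num))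
    simpa using this
  have hlog : Complex.log 4 = 2 * ((Real.log 2 : ℝ) : ℂ) := by
    have h1 : Real.log 4 = 2 * Real.log 2 := by
      rw [show (4 : ℝ) = 2 ^ 2 by norm_num, Real.log_pow]; norm_num
    have h2 : Complex.log ((4 : ℝ) : ℂ) = ((Real.log 4 : ℝ) : ℂ) := (Complex.ofReal_log (by norm_num)).symm
    rw [h1] at h2
    push_cast at h2 ⊢
    exact h2
  have hmul : HasDerivAt (fun s : ℂ => (4 : ℂ) ^ s * L s) _ 1 := hpow.mul hLd
  rw [hmul.deriv, hlog, Complex.cpow_one]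
  push_cast at hfin ⊢
  linear_combination hfin + (2 * ((Real.log 2 : ℝ) : ℂ) - (γ : ℂ)) * hL1
end

section
/- Let χ₋₃ be the unique nonprincipal Dirichlet character modulo 3. Then the derivative at s = 1 of the entire function s ↦ 3^s·L(χ₋₃, s) equals (π/√3)·( π/(2√3) + γ − 4·Σ_{ℓ=1}^∞ (−1)^ℓ / ( ℓ·((−1)^ℓ − e^{√3·πℓ}) ) ). -/
open Complex Real

namespace St6

def Q (p : ℤ × ℤ) : ℤ := p.1 ^ 2 + p.1 * p.2 + p.2 ^ 2

def rep (N : ℕ) : Set (ℤ × ℤ) := {p | Q p = N}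

def c3 (n : ℕ) : ℤ := if n % 3 = 1 then 1 else if n % 3 = 2 then -1 else 0

def g (N : ℕ) : ℤ := ∑ d ∈ N.divisors, c3 d

lemma c3_mul (a b : ℕ) : c3 (a * b) = c3 a * c3 b := by
  unfold c3
  rw [Nat.mul_mod]
  have ha : a % 3 < 3 := Nat.mod_lt _ (by norm_num)
  have hb : b % 3 < 3 := Nat.mod_lt _ (by norm_num)
  interval_cases a % 3 <;> interval_cases b % 3 <;> simp

lemma rep_finite (N : ℕ) : (rep N).Finite := by
  apply ((Set.finite_Icc (-(2 * N : ℤ)) (2 * N)).prod (Set.finite_Icc (-(2 * N : ℤ)) (2 * N))).subset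
  rintro ⟨m, n⟩ h
  simp only [rep, Q, Set.mem_ofPred_eq] at h
  have h1 : 3 * n ^ 2 ≤ 4 * N := by nlinarith [sq_nonneg (2 * m + n)]
  have h2 : 3 * m ^ 2 ≤ 4 * N := by nlinarith [sq_nonneg (2 * n + m)]
  have key : ∀ x : ℤ, 3 * x ^ 2 ≤ 4 * N → -(2 * N : ℤ) ≤ x ∧ x ≤ 2 * N := by
    intro x hx
    have : |x| ≤ x ^ 2 := by
      rw [← sq_abs]
      rcases eq_or_ne x 0 with rfl | h0
      · simp
      · have := Int.one_le_abs h0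
        nlinarith
    have h3 : |x| ≤ 2 * N := by linarith [abs_nonneg x]
    exact abs_le.mp h3
  exact ⟨key m h2, key n h1⟩

lemma g_hecke_dvd (p K : ℕ) (hp : p.Prime) (hK : 0 < K) :
    g (p * (p * K)) + c3 p * g K = (1 + c3 p) * g (p * K) := by
  have hp0 := hp.pos
  have inj : ∀ s : Finset ℕ, ∑ d ∈ s.image (p * ·), c3 d = c3 p * ∑ d ∈ s, c3 d := by
    intro s
    rw [Finset.sum_image (fun a _ b _ h => Nat.eq_of_mul_eq_mul_left hp0 h), Finset.mul_sum]
    exact Finset.sum_congr rfl (fun d _ => c3_mul p d)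
  have hU : (p * (p * K)).divisors = (p * K).divisors ∪ (p * K).divisors.image (p * ·) := by
    ext d
    simp only [Nat.mem_divisors, Finset.mem_union, Finset.mem_image]
    constructor
    · rintro ⟨h, _⟩
      by_cases hd : p ∣ d
      · obtain ⟨e, rfl⟩ := hd
        exact Or.inr ⟨e, ⟨Nat.dvd_of_mul_dvd_mul_left hp0 h, by positivity⟩, rfl⟩
      · refine Or.inl ⟨Nat.Coprime.dvd_of_dvd_mul_left ((Nat.Prime.coprime_iff_not_dvd hp).2 hd).symm h, by positivity⟩
    · rintro (⟨h, _⟩ | ⟨e, ⟨h, _⟩, rfl⟩)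
      · exact ⟨Dvd.dvd.mul_left h p, by positivity⟩
      · exact ⟨Nat.mul_dvd_mul_left p h, by positivity⟩
  have hI : (p * K).divisors ∩ (p * K).divisors.image (p * ·) = K.divisors.image (p * ·) := by
    ext d
    simp only [Nat.mem_divisors, Finset.mem_inter, Finset.mem_image]
    constructor
    · rintro ⟨⟨h, _⟩, e, ⟨h', _⟩, rfl⟩
      exact ⟨e, ⟨Nat.dvd_of_mul_dvd_mul_left hp0 h, by positivity⟩, rfl⟩
    · rintro ⟨e, ⟨h', _⟩, rfl⟩
      exact ⟨⟨Nat.mul_dvd_mul_left p h', by positivity⟩, e, ⟨Dvd.dvd.mul_left h' p, by positivity⟩, rfl⟩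
  have := Finset.sum_union_inter (s₁ := (p * K).divisors) (s₂ := (p * K).divisors.image (p * ·)) (f := c3)
  rw [← hU, hI, inj, inj] at this
  unfold g
  linarith

lemma g_hecke_ndvd (p M : ℕ) (hp : p.Prime) (hM : 0 < M) (hpM : ¬ p ∣ M) :
    g (p * M) = (1 + c3 p) * g M := by
  have hp0 := hp.pos
  have inj : ∀ s : Finset ℕ, ∑ d ∈ s.image (p * ·), c3 d = c3 p * ∑ d ∈ s, c3 d := by
    intro s
    rw [Finset.sum_image (fun a _ b _ h => Nat.eq_of_mul_eq_mul_left hp0 h), Finset.mul_sum]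
    exact Finset.sum_congr rfl (fun d _ => c3_mul p d)
  have hU : (p * M).divisors = M.divisors ∪ M.divisors.image (p * ·) := by
    ext d
    simp only [Nat.mem_divisors, Finset.mem_union, Finset.mem_image]
    constructor
    · rintro ⟨h, _⟩
      by_cases hd : p ∣ d
      · obtain ⟨e, rfl⟩ := hd
        exact Or.inr ⟨e, ⟨Nat.dvd_of_mul_dvd_mul_left hp0 h, by positivity⟩, rfl⟩
      · refine Or.inl ⟨Nat.Coprime.dvd_of_dvd_mul_left ((Nat.Prime.coprime_iff_not_dvd hp).2 hd).symm h, by positivity⟩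
    · rintro (⟨h, _⟩ | ⟨e, ⟨h, _⟩, rfl⟩)
      · exact ⟨Dvd.dvd.mul_left h p, by positivity⟩
      · exact ⟨Nat.mul_dvd_mul_left p h, by positivity⟩
  have hI : Disjoint M.divisors (M.divisors.image (p * ·)) := by
    rw [Finset.disjoint_left]
    intro d hd hd'
    simp only [Nat.mem_divisors, Finset.mem_image] at hd hd'
    obtain ⟨e, _, rfl⟩ := hd'
    exact hpM (dvd_trans (Dvd.intro _ rfl) hd.1)
  unfold g
  rw [hU, Finset.sum_union hI, inj]
  ring

/-- multiplication in the Eisenstein integers -/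
def mulE (a b : ℤ) (z : ℤ × ℤ) : ℤ × ℤ := (a * z.1 - b * z.2, a * z.2 + b * z.1 + b * z.2)

lemma Q_mulE (a b : ℤ) (z : ℤ × ℤ) : Q (mulE a b z) = Q (a, b) * Q z := by
  simp only [Q, mulE]; ring

lemma mulE_conj (a b : ℤ) (z : ℤ × ℤ) : mulE (a + b) (-b) (mulE a b z) = (Q (a, b) * z.1, Q (a, b) * z.2) := by
  simp only [Q, mulE, Prod.mk.injEq]; constructor <;> ring

lemma mulE_conj' (a b : ℤ) (z : ℤ × ℤ) : mulE a b (mulE (a + b) (-b) z) = (Q (a, b) * z.1, Q (a, b) * z.2) := by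
  simp only [Q, mulE, Prod.mk.injEq]; constructor <;> ring

lemma mulE_inj (a b : ℤ) (h : Q (a, b) ≠ 0) : Function.Injective (mulE a b) := by
  intro z w hzw
  have := congrArg (mulE (a + b) (-b)) hzw
  rw [mulE_conj, mulE_conj, Prod.mk.injEq] at this
  exact Prod.ext (mul_left_cancel₀ h this.1) (mul_left_cancel₀ h this.2)

lemma rep_three (M : ℕ) : (rep (3 * M)).ncard = (rep M).ncard := by
  have h3 : Q (1, 1) = 3 := by norm_num [Q]
  have : rep (3 * M) = Set.image (mulE 1 1) (rep M) := by
    ext ⟨m, n⟩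
    simp only [Set.mem_image, rep, Set.mem_ofPred_eq]
    constructor
    · intro h
      have h' : (3:ℤ) ∣ (m - n) := by
        have : (3:ℤ) ∣ (m - n) ^ 2 := by
          refine ⟨M - m * n, ?_⟩
          simp only [Q] at h; push_cast at h; linarith
        exact Int.prime_three.dvd_of_dvd_pow this
      obtain ⟨k, hk⟩ := h'
      have hw : mulE 1 1 (n + 2 * k, -k) = (m, n) := by
        simp only [mulE, Prod.mk.injEq]; constructor <;> linarith
      refine ⟨(n + 2 * k, -k), ?_, hw⟩
      have := Q_mulE 1 1 (n + 2 * k, -k)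
      rw [hw, h, h3] at this
      push_cast at this; linarith
    · rintro ⟨w, hw, hh⟩
      rw [← hh, Q_mulE, hw, h3]; push_cast; ring
  rw [this, Set.ncard_image_of_injective _ (mulE_inj 1 1 (by rw [h3]; norm_num))]

lemma scale_inj (p : ℤ) (hp : p ≠ 0) : Function.Injective (fun z : ℤ × ℤ => (p * z.1, p * z.2)) := by
  intro z w h
  simp only [Prod.mk.injEq] at h
  exact Prod.ext (mul_left_cancel₀ hp h.1) (mul_left_cancel₀ hp h.2)

lemma inert_dvd (p : ℕ) (hp : p.Prime) (h3 : p % 3 = 2) (m n : ℤ) (h : (p : ℤ) ∣ Q (m, n)) :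
    (p : ℤ) ∣ m ∧ (p : ℤ) ∣ n := by
  have := Fact.mk hp
  have key : ∀ x y : ZMod p, x ^ 2 + x * y + y ^ 2 = 0 → y = 0 := by
    intro x y hxy
    by_contra hy
    set r := x / y with hr
    have hx : x = r * y := (div_mul_cancel₀ x hy).symm
    have hr2 : r ^ 2 + r + 1 = 0 := by
      have : y ^ 2 * (r ^ 2 + r + 1) = 0 := by rw [← hxy, hx]; ring
      exact (mul_eq_zero.mp this).resolve_left (pow_ne_zero 2 hy)
    have hr3 : r ^ 3 = 1 := by
      have : r ^ 3 - 1 = (r - 1) * (r ^ 2 + r + 1) := by ring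
      rw [hr2, mul_zero] at this
      exact sub_eq_zero.mp this
    have hr0 : r ≠ 0 := by
      rintro h0; rw [h0] at hr3; norm_num at hr3
    have hf := ZMod.pow_card_sub_one_eq_one hr0
    have hpm : p - 1 = 3 * (p / 3) + 1 := by omega
    rw [hpm, pow_add, pow_mul, hr3, one_pow, one_mul, pow_one] at hf
    rw [hf] at hr2
    have h30 : ((3 : ℕ) : ZMod p) = 0 := by push_cast; linear_combination hr2
    rw [ZMod.natCast_eq_zero_iff] at h30
    have := (Nat.prime_dvd_prime_iff_eq hp Nat.prime_three).1 h30
    omega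
  have hz := (ZMod.intCast_zmod_eq_zero_iff_dvd _ p).2 h
  simp only [Q] at hz
  push_cast at hz
  constructor
  · rw [← ZMod.intCast_zmod_eq_zero_iff_dvd]
    exact key n m (by linear_combination hz)
  · rw [← ZMod.intCast_zmod_eq_zero_iff_dvd]
    exact key m n hz

lemma rep_inert_dvd (p K : ℕ) (hp : p.Prime) (h3 : p % 3 = 2) :
    (rep (p * (p * K))).ncard = (rep K).ncard := by
  have hp0 : (p : ℤ) ≠ 0 := by exact_mod_cast hp.ne_zero
  have : rep (p * (p * K)) = Set.image (fun z : ℤ × ℤ => ((p : ℤ) * z.1, (p : ℤ) * z.2)) (rep K) := by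
    ext ⟨m, n⟩
    simp only [Set.mem_image, rep, Set.mem_ofPred_eq]
    constructor
    · intro h
      obtain ⟨⟨a, rfl⟩, ⟨b, rfl⟩⟩ := inert_dvd p hp h3 m n (by rw [h]; push_cast; exact Dvd.intro _ rfl)
      refine ⟨(a, b), ?_, rfl⟩
      simp only [Q] at h ⊢
      push_cast at h
      apply mul_left_cancel₀ (pow_ne_zero 2 hp0)
      linarith
    · rintro ⟨w, hw, hh⟩
      rw [← hh]
      simp only [Q] at hw ⊢
      push_cast
      rw [← hw]; ring
  rw [this, Set.ncard_image_of_injective _ (scale_inj _ hp0)]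

lemma rep_inert_ndvd (p M : ℕ) (hp : p.Prime) (h3 : p % 3 = 2) (hM : ¬ p ∣ M) :
    (rep (p * M)).ncard = 0 := by
  have hp0 : (p : ℤ) ≠ 0 := by exact_mod_cast hp.ne_zero
  have : rep (p * M) = ∅ := by
    ext ⟨m, n⟩
    simp only [rep, Set.mem_ofPred_eq, Set.mem_empty_iff_false, iff_false]
    intro h
    obtain ⟨⟨a, rfl⟩, ⟨b, rfl⟩⟩ := inert_dvd p hp h3 m n (by rw [h]; push_cast; exact Dvd.intro _ rfl)
    apply hM
    have : (p : ℤ) ∣ M := by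
      refine ⟨Q (a, b), ?_⟩
      simp only [Q] at h ⊢
      push_cast at h
      apply mul_left_cancel₀ hp0
      linarith
    exact_mod_cast this
  rw [this, Set.ncard_empty]

lemma split_exists (p : ℕ) (hp : p.Prime) (h3 : p % 3 = 1) : ∃ a b : ℤ, Q (a, b) = p := by
  have := Fact.mk hp
  obtain ⟨r, hr⟩ : ∃ r : ZMod p, r ^ 2 + r + 1 = 0 := by
    have hc : 3 ∣ Fintype.card (ZMod p)ˣ := by
      rw [ZMod.card_units_eq_totient, Nat.totient_prime hp]; omega
    obtain ⟨u, hu⟩ := exists_prime_orderOf_dvd_card 3 hc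
    refine ⟨(u : ZMod p), ?_⟩
    have h1 : (u : ZMod p) ^ 3 = 1 := by
      have := pow_orderOf_eq_one u
      rw [hu] at this
      simpa using congrArg Units.val this
    have h2 : (u : ZMod p) - 1 ≠ 0 := by
      intro h
      have : u = 1 := Units.ext (by simpa using sub_eq_zero.mp h)
      rw [this, orderOf_one] at hu
      norm_num at hu
    apply (mul_eq_zero.mp (_ : ((u : ZMod p) - 1) * _ = 0)).resolve_left h2
    linear_combination h1
  set k := Nat.sqrt p with hk
  have hk1 : p < (k + 1) * (k + 1) := Nat.lt_succ_sqrt p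
  have hk2 : k * k < p := by
    refine lt_of_le_of_ne (Nat.sqrt_le p) ?_
    intro h
    have := hp
    rw [← h] at this
    exact Nat.not_prime_mul (by rintro h; rw [h] at this; norm_num at this) (by rintro h; rw [h] at this; norm_num at this) this
  obtain ⟨x, hx, y, hy, hxy, hf⟩ := Finset.exists_ne_map_eq_of_card_lt_of_maps_to
    (s := Finset.range (k + 1) ×ˢ Finset.range (k + 1)) (t := (Finset.univ : Finset (ZMod p)))
    (by rw [Finset.card_product, Finset.card_range, Finset.card_univ, ZMod.card]; exact hk1)
    (f := fun z => (z.1 : ZMod p) - r * z.2) (fun _ _ => Finset.mem_univ _)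
  simp only [Finset.mem_product, Finset.mem_range] at hx hy
  set a : ℤ := (x.1 : ℤ) - y.1 with ha
  set b : ℤ := (x.2 : ℤ) - y.2 with hb
  have hab : (a : ZMod p) = r * b := by
    rw [ha, hb]; push_cast; linear_combination hf
  have hdvd : (p : ℤ) ∣ Q (a, b) := by
    rw [← ZMod.intCast_zmod_eq_zero_iff_dvd]
    simp only [Q]; push_cast; rw [hab]; linear_combination (b : ZMod p) ^ 2 * hr
  have ha' : |a| ≤ k := by rw [abs_le]; constructor <;> omega
  have hb' : |b| ≤ k := by rw [abs_le]; constructor <;> omega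
  have ha2 : a ^ 2 ≤ k * k := by rw [← sq_abs]; nlinarith [abs_nonneg a]
  have hb2 : b ^ 2 ≤ k * k := by rw [← sq_abs]; nlinarith [abs_nonneg b]
  have hkp : (k * k : ℤ) < p := by exact_mod_cast hk2
  have hne : a ≠ 0 ∨ b ≠ 0 := by
    by_contra! h
    apply hxy
    apply Prod.ext <;> omega
  have hpos : 0 < Q (a, b) := by
    simp only [Q]
    rcases hne with h | h
    · have : 0 < a ^ 2 := by positivity
      nlinarith [sq_nonneg (a + 2 * b)]
    · have : 0 < b ^ 2 := by positivity
      nlinarith [sq_nonneg (2 * a + b)]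
  have hlt : Q (a, b) < 3 * p := by
    simp only [Q]; nlinarith [sq_nonneg (a - b)]
  obtain ⟨c, hc⟩ := hdvd
  have hp0 : (0 : ℤ) < p := by exact_mod_cast hp.pos
  have hc1 : 0 < c := by
    by_contra! h
    nlinarith
  have hc3 : c < 3 := by
    by_contra! h
    nlinarith
  interval_cases c
  · exact ⟨a, b, by linarith⟩
  · exfalso
    have hodd : p % 2 = 1 := by
      rcases hp.eq_two_or_odd with h | h
      · omega
      · exact h
    simp only [Q] at hc
    obtain ⟨q, hq⟩ : ∃ q : ℤ, (p : ℤ) = 2 * q + 1 := ⟨(p / 2 : ℕ), by omega⟩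
    rcases Int.even_or_odd' a with ⟨u, hu | hu⟩ <;> rcases Int.even_or_odd' b with ⟨v, hv | hv⟩ <;>
      rw [hu, hv, hq] at hc <;> ring_nf at hc <;> omega

lemma split_case (p : ℕ) (hp : p.Prime) (a b : ℤ) (hab : Q (a, b) = p) (m n : ℤ)
    (h : (p : ℤ) ∣ Q (m, n)) :
    (∃ w, mulE a b w = (m, n)) ∨ (∃ w, mulE (a + b) (-b) w = (m, n)) := by
  have hp0 : (p : ℤ) ≠ 0 := by exact_mod_cast hp.ne_zero
  have hpp : Prime (p : ℤ) := Nat.prime_iff_prime_int.mp hp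
  have hprod : (p : ℤ) ∣ (a * n - b * m) * (a * n + b * m + b * n) := by
    have : (a * n - b * m) * (a * n + b * m + b * n) = n ^ 2 * Q (a, b) - b ^ 2 * Q (m, n) := by
      simp only [Q]; ring
    rw [this, hab]
    exact dvd_sub (Dvd.intro_left _ rfl) (Dvd.dvd.mul_left h _)
  have gen : ∀ a b : ℤ, Q (a, b) = p → (p : ℤ) ∣ (mulE (a + b) (-b) (m, n)).2 →
      ∃ w, mulE a b w = (m, n) := by
    intro a b hab hd
    have h1 : (p : ℤ) ∣ Q (mulE (a + b) (-b) (m, n)) := by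
      rw [Q_mulE]; exact Dvd.dvd.mul_left h _
    have h2 : (p : ℤ) ∣ (mulE (a + b) (-b) (m, n)).1 := by
      apply hpp.dvd_of_dvd_pow (n := 2)
      have : (mulE (a + b) (-b) (m, n)).1 ^ 2 = Q (mulE (a + b) (-b) (m, n)) -
          (mulE (a + b) (-b) (m, n)).2 * ((mulE (a + b) (-b) (m, n)).1 + (mulE (a + b) (-b) (m, n)).2) := by
        simp only [Q]; ring
      rw [this]
      exact dvd_sub h1 (Dvd.dvd.mul_right hd _)
    obtain ⟨u, hu⟩ := h2
    obtain ⟨v, hv⟩ := hd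
    refine ⟨(u, v), ?_⟩
    have h4 := mulE_conj' a b (m, n)
    rw [hab] at h4
    have h5 : mulE (a + b) (-b) (m, n) = (p * u, p * v) := Prod.ext hu hv
    rw [h5] at h4
    simp only [mulE, Prod.mk.injEq] at h4 ⊢
    exact ⟨mul_left_cancel₀ hp0 (by linarith [h4.1]), mul_left_cancel₀ hp0 (by linarith [h4.2])⟩
  rcases hpp.dvd_or_dvd hprod with h1 | h1
  · left
    apply gen a b hab
    have e : (mulE (a + b) (-b) (m, n)).2 = a * n - b * m := by simp only [mulE]; ring
    rw [e]; exact h1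
  · right
    apply gen (a + b) (-b) (by rw [← hab]; simp only [Q]; ring)
    have e : (mulE (a + b + -b) (- -b) (m, n)).2 = a * n + b * m + b * n := by simp only [mulE]; ring
    rw [e]; exact h1

lemma split_union (p M : ℕ) (hp : p.Prime) (a b : ℤ) (hab : Q (a, b) = p) :
    rep (p * M) = Set.image (mulE a b) (rep M) ∪ Set.image (mulE (a + b) (-b)) (rep M) := by
  have hp0 : (p : ℤ) ≠ 0 := by exact_mod_cast hp.ne_zero
  have hab' : Q (a + b, -b) = p := by rw [← hab]; simp only [Q]; ring
  ext ⟨m, n⟩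
  simp only [Set.mem_union, Set.mem_image, rep, Set.mem_ofPred_eq]
  constructor
  · intro h
    rcases split_case p hp a b hab m n (by rw [h]; push_cast; exact Dvd.intro _ rfl) with ⟨w, hw⟩ | ⟨w, hw⟩
    · refine Or.inl ⟨w, ?_, hw⟩
      have := Q_mulE a b w
      rw [hw, h, hab] at this
      push_cast at this
      exact (mul_left_cancel₀ hp0 this).symm
    · refine Or.inr ⟨w, ?_, hw⟩
      have := Q_mulE (a + b) (-b) w
      rw [hw, h, hab'] at this
      push_cast at this
      exact (mul_left_cancel₀ hp0 this).symm
  · rintro (⟨w, hw, hh⟩ | ⟨w, hw, hh⟩)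
    · rw [← hh, Q_mulE, hab, hw]; push_cast; ring
    · rw [← hh, Q_mulE, hab', hw]; push_cast; ring

lemma split_inter (p : ℕ) (hp : p.Prime) (h3 : p % 3 = 1) (a b : ℤ) (hab : Q (a, b) = p)
    (w w' : ℤ × ℤ) (h : mulE a b w = mulE (a + b) (-b) w') :
    (p : ℤ) ∣ (mulE a b w).1 ∧ (p : ℤ) ∣ (mulE a b w).2 := by
  have hp0 : (p : ℤ) ≠ 0 := by exact_mod_cast hp.ne_zero
  have hpp : Prime (p : ℤ) := Nat.prime_iff_prime_int.mp hp
  have e1 := mulE_conj a b w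
  have e2 := mulE_conj' a b w'
  rw [← h] at e2
  generalize mulE a b w = z at *
  have hnd : ¬ (p : ℤ) ∣ 2 * a + b := by
    intro hd
    have hb : (p : ℤ) ∣ 3 * b ^ 2 := by
      have : 3 * b ^ 2 = 4 * Q (a, b) - (2 * a + b) * (2 * a + b) := by simp only [Q]; ring
      rw [this, hab]
      exact dvd_sub (Dvd.intro_left _ rfl) (Dvd.dvd.mul_right hd _)
    have hb' : (p : ℤ) ∣ b := by
      rcases hpp.dvd_or_dvd hb with h' | h'
      · have : p ∣ 3 := by exact_mod_cast h'
        have := (Nat.prime_dvd_prime_iff_eq hp Nat.prime_three).1 this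
        omega
      · exact hpp.dvd_of_dvd_pow h'
    have ha' : (p : ℤ) ∣ a := by
      apply hpp.dvd_of_dvd_pow (n := 2)
      have : a ^ 2 = Q (a, b) - b * (a + b) := by simp only [Q]; ring
      rw [this, hab]
      exact dvd_sub dvd_rfl (Dvd.dvd.mul_right hb' _)
    obtain ⟨u, hu⟩ := ha'
    obtain ⟨v, hv⟩ := hb'
    have : (p : ℤ) * (p * (u ^ 2 + u * v + v ^ 2)) = p * 1 := by
      rw [mul_one]; nth_rw 3 [← hab]; simp only [Q]; rw [hu, hv]; ring
    have := mul_left_cancel₀ hp0 this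
    exact hpp.not_isUnit (IsUnit.of_mul_eq_one _ this)
  have f1 := congrArg Prod.fst e1
  have f2 := congrArg Prod.snd e1
  have f3 := congrArg Prod.fst e2
  have f4 := congrArg Prod.snd e2
  rw [hab] at f1 f2 f3 f4
  simp only [mulE] at f1 f2 f3 f4
  constructor
  · refine (hpp.dvd_or_dvd (?_ : (p : ℤ) ∣ (2 * a + b) * z.1)).resolve_left hnd
    exact ⟨w.1 + w'.1, by linarith⟩
  · refine (hpp.dvd_or_dvd (?_ : (p : ℤ) ∣ (2 * a + b) * z.2)).resolve_left hnd
    exact ⟨w.2 + w'.2, by linarith⟩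

lemma rep_split_ndvd (p M : ℕ) (hp : p.Prime) (h3 : p % 3 = 1) (hM : ¬ p ∣ M) :
    (rep (p * M)).ncard = 2 * (rep M).ncard := by
  obtain ⟨a, b, hab⟩ := split_exists p hp h3
  have hp0 : (p : ℤ) ≠ 0 := by exact_mod_cast hp.ne_zero
  have hab' : Q (a + b, -b) = p := by rw [← hab]; simp only [Q]; ring
  have hdis : Disjoint (Set.image (mulE a b) (rep M)) (Set.image (mulE (a + b) (-b)) (rep M)) := by
    rw [Set.disjoint_left]
    rintro z ⟨w, hw, rfl⟩ ⟨w', hw', h⟩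
    obtain ⟨⟨u, hu⟩, ⟨v, hv⟩⟩ := split_inter p hp h3 a b hab w w' h.symm
    apply hM
    have h1 := Q_mulE a b w
    have h2 : mulE a b w = (p * u, p * v) := Prod.ext hu hv
    rw [h2, hab, show Q w = M from hw] at h1
    have : (p : ℤ) ∣ M := ⟨u ^ 2 + u * v + v ^ 2, mul_left_cancel₀ hp0 (by
      rw [← h1]; simp only [Q]; ring)⟩
    exact_mod_cast this
  rw [split_union p M hp a b hab, Set.ncard_union_eq hdis ((rep_finite M).image _) ((rep_finite M).image _),
    Set.ncard_image_of_injective _ (mulE_inj a b (by rw [hab]; exact hp0)),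
    Set.ncard_image_of_injective _ (mulE_inj _ _ (by rw [hab']; exact hp0))]
  ring

lemma rep_split_dvd (p K : ℕ) (hp : p.Prime) (h3 : p % 3 = 1) :
    (rep (p * (p * K))).ncard + (rep K).ncard = 2 * (rep (p * K)).ncard := by
  obtain ⟨a, b, hab⟩ := split_exists p hp h3
  have hp0 : (p : ℤ) ≠ 0 := by exact_mod_cast hp.ne_zero
  have hab' : Q (a + b, -b) = p := by rw [← hab]; simp only [Q]; ring
  have hI : Set.image (mulE a b) (rep (p * K)) ∩ Set.image (mulE (a + b) (-b)) (rep (p * K))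
      = Set.image (fun z : ℤ × ℤ => ((p : ℤ) * z.1, (p : ℤ) * z.2)) (rep K) := by
    ext z
    constructor
    · rintro ⟨⟨w, hw, rfl⟩, ⟨w', hw', h⟩⟩
      obtain ⟨⟨u, hu⟩, ⟨v, hv⟩⟩ := split_inter p hp h3 a b hab w w' h.symm
      have h1 := Q_mulE a b w
      have h2 : mulE a b w = (p * u, p * v) := Prod.ext hu hv
      rw [h2, hab, show Q w = _ from hw] at h1
      refine ⟨(u, v), ?_, h2.symm⟩
      simp only [rep, Set.mem_ofPred_eq]
      apply mul_left_cancel₀ (pow_ne_zero 2 hp0)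
      push_cast at h1
      simp only [Q] at h1 ⊢
      linarith
    · rintro ⟨w, hw, rfl⟩
      refine ⟨⟨mulE (a + b) (-b) w, ?_, ?_⟩, ⟨mulE a b w, ?_, ?_⟩⟩
      · simp only [rep, Set.mem_ofPred_eq] at hw ⊢
        rw [Q_mulE, hab', hw]; push_cast; ring
      · rw [mulE_conj', hab]
      · simp only [rep, Set.mem_ofPred_eq] at hw ⊢
        rw [Q_mulE, hab, hw]; push_cast; ring
      · rw [mulE_conj, hab]
  have := Set.ncard_union_add_ncard_inter (Set.image (mulE a b) (rep (p * K))) (Set.image (mulE (a + b) (-b)) (rep (p * K)))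
    ((rep_finite _).image _) ((rep_finite _).image _)
  rw [hI, ← split_union p (p * K) hp a b hab, 
    Set.ncard_image_of_injective _ (mulE_inj a b (by rw [hab]; exact hp0)),
    Set.ncard_image_of_injective _ (mulE_inj _ _ (by rw [hab']; exact hp0)),
    Set.ncard_image_of_injective _ (scale_inj _ hp0)] at this
  linarith

lemma rep_one : (rep 1).ncard = 6 := by
  have : rep 1 = (({(1, 0), (-1, 0), (0, 1), (0, -1), (1, -1), (-1, 1)} : Finset (ℤ × ℤ)) : Set (ℤ × ℤ)) := by
    ext ⟨m, n⟩
    simp only [rep, Q, Set.mem_ofPred_eq, Finset.coe_insert, Finset.coe_singleton, Set.mem_insert_iff, Set.mem_singleton_iff, Prod.mk.injEq]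
    constructor
    · intro h
      push_cast at h
      have h1 : -1 ≤ n := by nlinarith [sq_nonneg (2 * m + n)]
      have h2 : n ≤ 1 := by nlinarith [sq_nonneg (2 * m + n)]
      have h3 : -1 ≤ m := by nlinarith [sq_nonneg (2 * n + m)]
      have h4 : m ≤ 1 := by nlinarith [sq_nonneg (2 * n + m)]
      interval_cases m <;> interval_cases n <;> simp_all
    · rintro (⟨rfl, rfl⟩ | ⟨rfl, rfl⟩ | ⟨rfl, rfl⟩ | ⟨rfl, rfl⟩ | ⟨rfl, rfl⟩ | ⟨rfl, rfl⟩) <;> norm_num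
  rw [this, Set.ncard_coe_finset]
  rfl

theorem rep_eq (N : ℕ) (hN : 0 < N) : ((rep N).ncard : ℤ) = 6 * g N := by
  induction N using Nat.strong_induction_on with
  | _ N ih =>
  rcases Nat.lt_or_ge 1 N with h1 | h1
  swap
  · have : N = 1 := by omega
    subst this
    rw [rep_one]; simp [g, c3]
  obtain ⟨p, hp, M, rfl⟩ := Nat.exists_prime_and_dvd (n := N) (by omega)
  have hM : 0 < M := Nat.pos_of_mul_pos_left hN |> fun h => by
    rcases Nat.eq_zero_or_pos M with h | h
    · subst h; simp at hN
    · exact h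
  have hMlt : M < p * M := by nlinarith [hp.two_le]
  have ihM := ih M hMlt hM
  by_cases hpM : p ∣ M
  · obtain ⟨K, rfl⟩ := hpM
    have hK : 0 < K := by
      rcases Nat.eq_zero_or_pos K with h | h
      · subst h; simp at hN
      · exact h
    have hKlt : K < p * K := by nlinarith [hp.two_le]
    have ihK := ih K (hKlt.trans hMlt) hK
    have hg := g_hecke_dvd p K hp hK
    have : p % 3 = 0 ∨ p % 3 = 1 ∨ p % 3 = 2 := by omega
    rcases this with h | h | h
    · have hp3 : p = 3 := ((Nat.prime_dvd_prime_iff_eq Nat.prime_three hp).1 (Nat.dvd_of_mod_eq_zero h)).symm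
      subst hp3
      rw [rep_three, ihM]
      simp [c3] at hg
      rw [hg]
    · have := rep_split_dvd p K hp h
      zify at this
      simp [c3, h] at hg
      linarith
    · rw [rep_inert_dvd p K hp h, ihK]
      simp [c3, h] at hg
      linarith
  · have hg := g_hecke_ndvd p M hp hM hpM
    have : p % 3 = 0 ∨ p % 3 = 1 ∨ p % 3 = 2 := by omega
    rcases this with h | h | h
    · have hp3 : p = 3 := ((Nat.prime_dvd_prime_iff_eq Nat.prime_three hp).1 (Nat.dvd_of_mod_eq_zero h)).symm
      subst hp3
      rw [rep_three, ihM]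
      simp [c3] at hg
      rw [hg]
    · have := rep_split_ndvd p M hp h hpM
      zify at this
      simp [c3, h] at hg
      linarith
    · rw [rep_inert_ndvd p M hp h hpM]
      simp [c3, h] at hg
      simp [hg]

end St6

namespace St6

lemma chi_eq (χ : DirichletCharacter ℂ 3) (hχ : χ ≠ 1) (n : ℕ) : χ (n : ZMod 3) = (c3 n : ℂ) := by
  have h2 : χ 2 = -1 := by
    have hsq : χ 2 * χ 2 = 1 := by
      rw [← map_mul, show (2 : ZMod 3) * 2 = 1 from by decide, map_one]
    rcases mul_self_eq_one_iff.mp hsq with h | h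
    · exfalso
      apply hχ
      ext u
      have : ∀ u : (ZMod 3)ˣ, (u : ZMod 3) = 1 ∨ (u : ZMod 3) = 2 := by decide
      rcases this u with hu | hu <;> rw [hu]
      · simp
      · rw [h, show (2 : ZMod 3) = ((-1 : (ZMod 3)ˣ) : ZMod 3) from by decide, MulChar.one_apply_coe]
    · exact h
  have h0 : χ 0 = 0 := χ.map_nonunit (by decide)
  have hn : (n : ZMod 3) = ((n % 3 : ℕ) : ZMod 3) := by simp
  rw [hn]
  unfold c3
  have hb : n % 3 < 3 := Nat.mod_lt _ (by norm_num)
  interval_cases n % 3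
  · simpa using h0
  · simp
  · simpa using h2

lemma Q_nonneg (p : ℤ × ℤ) : 0 ≤ Q p := by
  simp only [Q]; nlinarith [sq_nonneg (2 * p.1 + p.2), sq_nonneg p.2]

lemma term_eq (χ : DirichletCharacter ℂ 3) (hχ : χ ≠ 1) (s : ℝ) (hs : 1 < s) (N : ℕ) :
    LSeries.term (LSeries.convolution 1 (fun n : ℕ => χ (n : ZMod 3))) s N
      = (((g N : ℝ) * (N : ℝ) ^ (-s) : ℝ) : ℂ) := by
  rcases Nat.eq_zero_or_pos N with rfl | hN
  · simp [Real.zero_rpow (show -s ≠ 0 by linarith)]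
  · rw [LSeries.term_of_ne_zero hN.ne', LSeries.convolution_def]
    simp only [Pi.one_apply, one_mul]
    rw [Nat.sum_divisorsAntidiagonal' (f := fun a b => χ (b : ZMod 3))]
    simp only [chi_eq χ hχ]
    push_cast [g]
    rw [Real.rpow_neg (by positivity), Complex.ofReal_inv, Complex.ofReal_cpow (by positivity)]
    simp [div_eq_mul_inv]

theorem zetaL (χ : DirichletCharacter ℂ 3) (hχ : χ ≠ 1) (s : ℝ) (hs : 1 < s) :
    Summable (fun p : ℤ × ℤ => ((Q p : ℤ) : ℝ) ^ (-s)) ∧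
    riemannZeta s * DirichletCharacter.LFunction χ s =
      (1 / 6) * ((∑' p : ℤ × ℤ, ((Q p : ℤ) : ℝ) ^ (-s) : ℝ) : ℂ) := by
  have hs' : 1 < (s : ℂ).re := by simpa using hs
  have hz : LSeriesSummable 1 (s : ℂ) := LSeriesSummable_one_iff.2 hs'
  have hl := DirichletCharacter.LSeriesSummable_of_one_lt_re χ hs'
  have hconv := LSeries_convolution' hz hl
  have hsum := LSeriesSummable.convolution hz hl
  rw [LSeries_one_eq_riemannZeta hs', ← DirichletCharacter.LFunction_eq_LSeries χ hs'] at hconv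
  have hterm := fun N => term_eq χ hχ s hs N
  have hsumR : Summable (fun N : ℕ => (g N : ℝ) * (N : ℝ) ^ (-s)) := by
    have : Summable (fun N : ℕ => (((g N : ℝ) * (N : ℝ) ^ (-s) : ℝ) : ℂ)) := by
      rw [← funext hterm]; exact hsum
    exact Complex.summable_ofReal.mp this
  have htsum : LSeries (LSeries.convolution 1 (fun n : ℕ => χ (n : ZMod 3))) s =
      ((∑' N : ℕ, (g N : ℝ) * (N : ℝ) ^ (-s) : ℝ) : ℂ) := by
    rw [LSeries, Complex.ofReal_tsum]
    exact tsum_congr hterm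
  set e := Equiv.sigmaFiberEquiv (fun p : ℤ × ℤ => (Q p).toNat) with he
  have hfib : ∀ N : ℕ, ∀ q : {p : ℤ × ℤ // (Q p).toNat = N}, ((Q q.1 : ℤ) : ℝ) = N := by
    rintro N ⟨p, hp⟩
    have : Q p = N := by have := Q_nonneg p; omega
    simp [this]
  have hcard : ∀ N : ℕ, Nat.card {p : ℤ × ℤ // (Q p).toNat = N} = (rep N).ncard := by
    intro N
    rw [← Nat.card_coe_set_eq]
    apply Nat.card_congr
    apply Equiv.subtypeEquivRight
    intro p
    have := Q_nonneg p
    simp only [rep, Set.mem_ofPred_eq]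
    omega
  have hfin : ∀ N : ℕ, Finite {p : ℤ × ℤ // (Q p).toNat = N} := by
    intro N
    have : {p : ℤ × ℤ | (Q p).toNat = N} = rep N := by
      ext p
      have := Q_nonneg p
      simp only [rep, Set.mem_ofPred_eq]
      omega
    have h2 : {p : ℤ × ℤ | (Q p).toNat = N}.Finite := this ▸ rep_finite N
    exact h2.to_subtype
  have hin : ∀ N : ℕ, ∑' q : {p : ℤ × ℤ // (Q p).toNat = N}, ((Q q.1 : ℤ) : ℝ) ^ (-s)
      = 6 * ((g N : ℝ) * (N : ℝ) ^ (-s)) := by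
    intro N
    simp only [hfib N]
    rw [tsum_const, hcard, nsmul_eq_mul]
    rcases Nat.eq_zero_or_pos N with rfl | hN
    · simp [Real.zero_rpow (show -s ≠ 0 by linarith)]
    · have := rep_eq N hN
      have h' : ((rep N).ncard : ℝ) = 6 * (g N : ℝ) := by exact_mod_cast this
      rw [h']; ring
  have hS : Summable ((fun p : ℤ × ℤ => ((Q p : ℤ) : ℝ) ^ (-s)) ∘ e) := by
    rw [summable_sigma_of_nonneg]
    · refine ⟨fun N => ?_, ?_⟩
      · have := hfin N
        exact Summable.of_finite
      · have : (fun N : ℕ => ∑' q : {p : ℤ × ℤ // (Q p).toNat = N}, ((fun p : ℤ × ℤ => ((Q p : ℤ) : ℝ) ^ (-s)) ∘ e) ⟨N, q⟩)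
            = fun N : ℕ => 6 * ((g N : ℝ) * (N : ℝ) ^ (-s)) := by
          funext N
          exact hin N
        rw [this]
        exact hsumR.mul_left 6
    · intro x
      exact Real.rpow_nonneg (by exact_mod_cast Q_nonneg _) _
  refine ⟨(e.summable_iff).1 hS, ?_⟩
  rw [← hconv, htsum, ← e.tsum_eq (fun p : ℤ × ℤ => ((Q p : ℤ) : ℝ) ^ (-s))]
  rw [hS.tsum_sigma (f := fun x => ((Q (e x) : ℤ) : ℝ) ^ (-s))]
  have : ∀ N : ℕ, ∑' q : {p : ℤ × ℤ // (Q p).toNat = N}, ((Q (e ⟨N, q⟩) : ℤ) : ℝ) ^ (-s)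
      = 6 * ((g N : ℝ) * (N : ℝ) ^ (-s)) := hin
  simp only [this]
  rw [tsum_mul_left]
  push_cast
  ring

end St6

namespace St6
open MeasureTheory

lemma sum_sub_integral (f f' G : ℝ → ℝ) (hf : ∀ x, HasDerivAt f (f' x) x) (hfi : Integrable f)
    (hGi : Integrable G) (hb : ∀ x, |f' x| ≤ G x) (hc : Continuous f') (a : ℝ) :
    Summable (fun m : ℤ => f (a + m)) ∧ |∑' m : ℤ, f (a + m) - ∫ x, f x| ≤ ∫ x, G x := by
  have hG0 : ∀ x, 0 ≤ G x := fun x => (abs_nonneg _).trans (hb x)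
  have h1 := hfi.hasSum_intervalIntegral a
  have h2 := hGi.hasSum_intervalIntegral a
  have hfc : Continuous f := continuous_iff_continuousAt.2 fun x => (hf x).continuousAt
  have key : ∀ c : ℝ, |f c - ∫ x in c..c + 1, f x| ≤ ∫ x in c..c + 1, G x := by
    intro c
    have e : f c - ∫ x in c..c + 1, f x = ∫ x in c..c + 1, (f c - f x) := by
      rw [intervalIntegral.integral_sub (by simp) (hfc.intervalIntegrable _ _)]
      simp
    have hpt : ∀ x ∈ Set.uIoc c (c + 1), ‖f c - f x‖ ≤ ∫ x in c..c + 1, G x := by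
      intro x hx
      rw [Set.uIoc_of_le (by linarith)] at hx
      have h3 : ∫ y in c..x, f' y = f x - f c :=
        intervalIntegral.integral_eq_sub_of_hasDerivAt (fun y _ => hf y) (hc.intervalIntegrable _ _)
      rw [norm_sub_rev, ← h3]
      calc ‖∫ y in c..x, f' y‖ ≤ ∫ y in c..x, G y :=
            intervalIntegral.norm_integral_le_of_norm_le hx.1.le
              (Filter.Eventually.of_forall fun y _ => hb y) hGi.intervalIntegrable
        _ ≤ ∫ y in c..c + 1, G y :=
            intervalIntegral.integral_mono_interval le_rfl hx.1.le hx.2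
              (Filter.Eventually.of_forall hG0) hGi.intervalIntegrable
    rw [e]
    have := intervalIntegral.norm_integral_le_of_norm_le_const hpt
    simpa using this
  have hd : Summable (fun m : ℤ => f (a + m) - ∫ x in a + m..a + m + 1, f x) :=
    Summable.of_norm_bounded h2.summable (fun m => key (a + m))
  have hs : Summable (fun m : ℤ => f (a + m)) := by
    have := hd.add h1.summable
    simpa using this
  refine ⟨hs, ?_⟩
  rw [← h1.tsum_eq, ← hs.tsum_sub h1.summable, ← h2.tsum_eq]
  exact tsum_of_norm_bounded (f := fun m : ℤ => f (a + m) - ∫ x in a + m..a + m + 1, f x)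
    h2.summable.hasSum (fun m => key (a + m))

/-- the basic kernel -/
noncomputable def phi (s v : ℝ) : ℝ := (v ^ 2 + 3 / 4) ^ (-s)

noncomputable def cc (s : ℝ) : ℝ := ∫ v, phi s v

lemma phi_deriv (s v : ℝ) : HasDerivAt (phi s) (2 * v * (-s) * (v ^ 2 + 3 / 4) ^ (-s - 1)) v := by
  have h : HasDerivAt (fun v : ℝ => v ^ 2 + 3 / 4) (2 * v) v := by
    simpa using (hasDerivAt_pow 2 v).add_const (3 / 4 : ℝ)
  exact h.rpow_const (Or.inl (by positivity))

lemma phi_pow_bound (s v : ℝ) (hs : 1 ≤ s) (hs2 : s ≤ 2) :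
    (v ^ 2 + 3 / 4) ^ (-s - 1) ≤ (4 / 3) * ((v ^ 2 + 3 / 4) ^ 2)⁻¹ := by
  have hB : 3 / 4 ≤ v ^ 2 + 3 / 4 := by nlinarith [sq_nonneg v]
  set B := v ^ 2 + 3 / 4
  have hB0 : 0 < B := by linarith
  have e : B ^ (-s - 1) = B ^ (-(s - 1)) * (B ^ 2)⁻¹ := by
    rw [← Real.rpow_natCast B 2, ← Real.rpow_neg hB0.le, ← Real.rpow_add hB0]
    congr 1; push_cast; ring
  rw [e]
  gcongr
  calc B ^ (-(s - 1)) ≤ (3 / 4 : ℝ) ^ (-(s - 1)) :=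
        Real.rpow_le_rpow_of_nonpos (by norm_num) hB (by linarith)
    _ ≤ (3 / 4 : ℝ) ^ (-1 : ℝ) :=
        Real.rpow_le_rpow_of_exponent_ge (by norm_num) (by norm_num) (by linarith)
    _ = 4 / 3 := by rw [Real.rpow_neg_one]; norm_num

lemma phi_deriv_bound (s v : ℝ) (hs : 1 ≤ s) (hs2 : s ≤ 2) :
    |2 * v * (-s) * (v ^ 2 + 3 / 4) ^ (-s - 1)| ≤ 8 * (1 + v ^ 2)⁻¹ := by
  have hpb := phi_pow_bound s v hs hs2
  have hB : 3 / 4 ≤ v ^ 2 + 3 / 4 := by nlinarith [sq_nonneg v]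
  have hB1 : 3 / 4 * (1 + v ^ 2) ≤ v ^ 2 + 3 / 4 := by nlinarith [sq_nonneg v]
  have hv : |v| ≤ v ^ 2 + 3 / 4 := by
    rw [← sq_abs]; nlinarith [sq_nonneg (|v| - 1 / 2)]
  set B := v ^ 2 + 3 / 4
  have hB0 : 0 < B := by linarith
  have hpow : 0 ≤ B ^ (-s - 1) := by positivity
  rw [abs_mul, abs_mul, abs_mul, abs_of_nonneg hpow, abs_neg, abs_of_nonneg (by linarith : (0:ℝ) ≤ s), abs_two]
  calc 2 * |v| * s * B ^ (-s - 1) ≤ 2 * B * 2 * ((4 / 3) * (B ^ 2)⁻¹) := by gcongr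
    _ = 16 / 3 * B⁻¹ := by field_simp; ring
    _ ≤ 16 / 3 * (3 / 4 * (1 + v ^ 2))⁻¹ := by gcongr
    _ ≤ 8 * (1 + v ^ 2)⁻¹ := by
      rw [mul_inv, ← mul_assoc]; gcongr; norm_num

lemma phi_cont (s : ℝ) : Continuous (phi s) := continuous_iff_continuousAt.2 fun x => (phi_deriv s x).continuousAt

lemma phi_integrable (s : ℝ) (hs : 1 ≤ s) (hs2 : s ≤ 2) : Integrable (phi s) := by
  refine Integrable.mono' (integrable_inv_one_add_sq.const_mul 2) (phi_cont s).aestronglyMeasurable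
    (Filter.Eventually.of_forall fun v => ?_)
  have hB : 3 / 4 ≤ v ^ 2 + 3 / 4 := by nlinarith [sq_nonneg v]
  have hB1 : 3 / 4 * (1 + v ^ 2) ≤ v ^ 2 + 3 / 4 := by nlinarith [sq_nonneg v]
  have hpb := phi_pow_bound s v hs hs2
  unfold phi
  set B := v ^ 2 + 3 / 4
  have hB0 : 0 < B := by linarith
  rw [Real.norm_of_nonneg (by positivity)]
  calc B ^ (-s) = B * B ^ (-s - 1) := by rw [Real.rpow_sub_one hB0.ne']; field_simp
    _ ≤ B * ((4 / 3) * (B ^ 2)⁻¹) := by gcongr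
    _ = 4 / 3 * B⁻¹ := by field_simp
    _ ≤ 4 / 3 * (3 / 4 * (1 + v ^ 2))⁻¹ := by gcongr
    _ ≤ 2 * (1 + v ^ 2)⁻¹ := by
      rw [mul_inv, ← mul_assoc]; gcongr; norm_num

lemma phi_sum (s : ℝ) (hs : 1 ≤ s) (hs2 : s ≤ 2) (n : ℕ) (hn : 0 < n) :
    Summable (fun m : ℤ => phi s (((n : ℝ) / 2 + m) / n)) ∧
      |∑' m : ℤ, phi s (((n : ℝ) / 2 + m) / n) - n * cc s| ≤ 8 * π := by
  have hn0 : (0 : ℝ) < n := by exact_mod_cast hn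
  have hder : ∀ x : ℝ, HasDerivAt (fun x : ℝ => phi s (x / n))
      ((2 * (x / n) * (-s) * ((x / n) ^ 2 + 3 / 4) ^ (-s - 1)) * (1 / n)) x := by
    intro x
    exact (phi_deriv s (x / n)).comp x ((hasDerivAt_id x).div_const (n : ℝ))
  have hfi : Integrable (fun x : ℝ => phi s (x / n)) := (phi_integrable s hs hs2).comp_div hn0.ne'
  have hGi : Integrable (fun x : ℝ => (8 : ℝ) * (1 + (x / (n : ℝ)) ^ 2)⁻¹ * (1 / (n : ℝ))) :=
    (((integrable_inv_one_add_sq).comp_div hn0.ne').const_mul 8).mul_const _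
  have hcont : Continuous (fun x : ℝ => (2 * (x / n) * (-s) * ((x / n) ^ 2 + 3 / 4) ^ (-s - 1)) * (1 / (n : ℝ))) := by
    have : Continuous (fun x : ℝ => ((x / n) ^ 2 + 3 / 4) ^ (-s - 1)) := by
      apply Continuous.rpow_const (by fun_prop)
      intro x; left; positivity
    fun_prop
  have := sum_sub_integral _ _ _ hder hfi hGi (fun x => by
    rw [abs_mul, abs_of_pos (by positivity : 0 < 1 / (n : ℝ))]
    gcongr
    exact phi_deriv_bound s (x / n) hs hs2) hcont (n / 2)
  have e1 : ∫ x : ℝ, phi s (x / n) = n * cc s := by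
    rw [Measure.integral_comp_div (phi s) (n : ℝ), abs_of_pos hn0]; rfl
  have e2 : ∫ x : ℝ, 8 * (1 + (x / n) ^ 2)⁻¹ * (1 / (n : ℝ)) = 8 * π := by
    rw [integral_mul_const, integral_const_mul, Measure.integral_comp_div (fun x : ℝ => (1 + x ^ 2)⁻¹) (n : ℝ),
      abs_of_pos hn0, integral_univ_inv_one_add_sq]
    simp only [smul_eq_mul]; field_simp
  rw [e1, e2] at this
  exact this

lemma cc_eq (s : ℝ) (hs : 1 / 2 < s) :
    cc s = (3 / 4 : ℝ) ^ (1 / 2 - s) * √π * Real.Gamma (s - 1 / 2) / Real.Gamma s := by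
  have hG : 0 < Real.Gamma s := Real.Gamma_pos_of_pos (by linarith)
  rw [eq_div_iff hG.ne']
  set K : ℝ → ℝ → ℝ := fun t v => t ^ (s - 1) * Real.exp (-((v ^ 2 + 3 / 4) * t)) with hK
  have hinner1 : ∀ v : ℝ, ∫ t in Set.Ioi 0, K t v = phi s v * Real.Gamma s := by
    intro v
    rw [hK]
    simp only
    rw [Real.integral_rpow_mul_exp_neg_mul_Ioi (by linarith) (by positivity), phi, one_div,
      Real.inv_rpow (by positivity), Real.rpow_neg (by positivity)]
  have hinner2 : ∀ t ∈ Set.Ioi (0 : ℝ), ∫ v, K t v = √π * (t ^ ((s - 1 / 2) - 1) * Real.exp (-(3 / 4 * t))) := by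
    intro t ht
    have ht : 0 < t := ht
    have e : ∀ v, K t v = (t ^ (s - 1) * Real.exp (-(3 / 4 * t))) * Real.exp (-t * v ^ 2) := by
      intro v
      simp only [hK]
      rw [mul_assoc, ← Real.exp_add]; congr 2; ring
    simp only [e]
    rw [integral_const_mul, integral_gaussian, Real.sqrt_div pi_pos.le,
      show s - 1 / 2 - 1 = (s - 1) - 1 / 2 by ring, Real.rpow_sub ht (s - 1) (1 / 2), ← Real.sqrt_eq_rpow]
    ring
  have hKint : Integrable (Function.uncurry K) ((volume.restrict (Set.Ioi 0)).prod volume) := by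
    have hmeas : AEStronglyMeasurable (Function.uncurry K) ((volume.restrict (Set.Ioi 0)).prod volume) := by
      apply Measurable.aestronglyMeasurable
      simp only [hK, Function.uncurry_def]
      fun_prop
    rw [integrable_prod_iff hmeas]
    constructor
    · filter_upwards [ae_restrict_mem measurableSet_Ioi] with t ht
      have ht : 0 < t := ht
      have e : (fun v => Function.uncurry K (t, v)) = fun v => (t ^ (s - 1) * Real.exp (-(3 / 4 * t))) * Real.exp (-t * v ^ 2) := by
        funext v
        simp only [hK, Function.uncurry_apply_pair]
        rw [mul_assoc, ← Real.exp_add]; congr 2; ring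
      rw [e]
      exact (integrable_exp_neg_mul_sq ht).const_mul _
    · have h1 : IntegrableOn (fun t : ℝ => √π * (t ^ ((s - 1 / 2) - 1) * Real.exp (-(3 / 4 * t)))) (Set.Ioi 0) := by
        apply Integrable.const_mul
        have := integrableOn_rpow_mul_exp_neg_mul_rpow (p := 1) (s := s - 1 / 2 - 1) (b := 3 / 4) (by linarith) (by norm_num) (by norm_num)
        have h' : IntegrableOn (fun x : ℝ => x ^ (s - 1 / 2 - 1) * Real.exp (-(3 / 4 * x))) (Set.Ioi 0) := by
          simpa [neg_mul] using this
        exact h'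
      refine Integrable.congr h1 ?_
      filter_upwards [ae_restrict_mem measurableSet_Ioi] with t ht
      rw [← hinner2 t ht]
      have ht : 0 < t := ht
      apply integral_congr_ae
      filter_upwards with v
      simp only [hK, Function.uncurry_apply_pair]
      rw [Real.norm_of_nonneg (by positivity)]
  have hswap := integral_integral_swap hKint
  simp only [hinner1] at hswap
  rw [integral_mul_const] at hswap
  rw [cc, ← hswap, setIntegral_congr_fun measurableSet_Ioi hinner2, integral_const_mul,
    Real.integral_rpow_mul_exp_neg_mul_Ioi (by linarith) (by norm_num), one_div (3 / 4 : ℝ), Real.inv_rpow (by norm_num),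
    ← Real.rpow_neg (by norm_num), show -(s - 1 / 2) = 1 / 2 - s by ring]
  ring

lemma cc_one : cc 1 = 2 * π / √3 := by
  rw [cc_eq 1 (by norm_num)]
  norm_num
  rw [Real.Gamma_one_half_eq, Real.rpow_neg (by norm_num), ← Real.sqrt_eq_rpow, Real.sqrt_div (by norm_num),
    show (4:ℝ) = 2 ^ 2 by norm_num, Real.sqrt_sq (by norm_num), inv_div, mul_assoc, Real.mul_self_sqrt pi_pos.le]
  ring

/-- the function `3^(s-1) * cc s` has vanishing derivative at one -/
lemma H_deriv : HasDerivAt (fun s : ℝ => (3 : ℝ) ^ (s - 1) * cc s) 0 1 := by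
  have h0 : HasDerivAt (fun s : ℝ => (3 : ℝ) ^ (s - 1) * ((3 / 4 : ℝ) ^ (1 / 2 - s) * √π * Real.Gamma (s - 1 / 2) / Real.Gamma s)) 0 1 := by
    have h3 : HasDerivAt (fun s : ℝ => (3 : ℝ) ^ (s - 1)) (Real.log 3 * 1 * 3 ^ ((1:ℝ) - 1)) 1 :=
      ((hasDerivAt_id (1:ℝ)).sub_const 1).const_rpow (by norm_num)
    have h4 : HasDerivAt (fun s : ℝ => (3 / 4 : ℝ) ^ (1 / 2 - s)) (Real.log (3/4) * (-1) * (3/4) ^ (1/2 - (1:ℝ))) 1 :=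
      ((hasDerivAt_id (1:ℝ)).const_sub (1/2)).const_rpow (by norm_num)
    have h5 : HasDerivAt (fun s : ℝ => Real.Gamma (s - 1 / 2)) (-√π * (Real.eulerMascheroniConstant + 2 * Real.log 2)) 1 := by
      have := Real.hasDerivAt_Gamma_one_half
      rw [show (1 / 2 : ℝ) = 1 - 1 / 2 by norm_num] at this
      have := this.comp (1:ℝ) ((hasDerivAt_id (1:ℝ)).sub_const (1/2))
      simpa [Function.comp_def] using this
    have h6 := Real.hasDerivAt_Gamma_one
    have := h3.mul (((h4.mul_const (√π)).mul h5).div h6 (by rw [Real.Gamma_one]; norm_num))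
    refine HasDerivAt.congr_deriv this ?_
    simp only [Pi.mul_apply, Pi.div_apply]
    rw [Real.Gamma_one, show (1 : ℝ) - 1 / 2 = 1 / 2 by norm_num, Real.Gamma_one_half_eq, sub_self, Real.rpow_zero,
      Real.log_div (by norm_num) (by norm_num), show (4:ℝ) = 2 ^ 2 by norm_num, Real.log_pow]
    push_cast
    ring
  refine h0.congr_of_eventuallyEq ?_
  filter_upwards [lt_mem_nhds (show (1 / 2 : ℝ) < 1 by norm_num)] with s hs
  rw [cc_eq s hs]

end St6

namespace St6
open MeasureTheory Filter Topology

noncomputable def FF (n : ℤ) (s : ℝ) : ℝ := ∑' m : ℤ, ((Q (n, m) : ℤ) : ℝ) ^ (-s)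

noncomputable def DD (n : ℕ) (s : ℝ) : ℝ := FF n s - (n : ℝ) ^ (1 - 2 * s) * cc s

lemma Q_real (n : ℕ) (m : ℤ) (hn : 0 < n) :
    ((Q ((n : ℤ), m) : ℤ) : ℝ) = (n : ℝ) ^ 2 * ((((n : ℝ) / 2 + m) / n) ^ 2 + 3 / 4) := by
  have : (n : ℝ) ≠ 0 := by positivity
  simp only [Q]
  push_cast
  field_simp
  ring

lemma Q_pow (n : ℕ) (m : ℤ) (hn : 0 < n) (s : ℝ) :
    ((Q ((n : ℤ), m) : ℤ) : ℝ) ^ (-s) = (n : ℝ) ^ (-(2 * s)) * phi s (((n : ℝ) / 2 + m) / n) := by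
  rw [Q_real n m hn, Real.mul_rpow (by positivity) (by positivity), phi,
    ← Real.rpow_natCast, ← Real.rpow_mul (by positivity)]
  congr 2
  push_cast
  ring

lemma FF_summable (n : ℕ) (hn : 0 < n) (s : ℝ) (hs : 1 ≤ s) (hs2 : s ≤ 2) :
    Summable (fun m : ℤ => ((Q ((n : ℤ), m) : ℤ) : ℝ) ^ (-s)) := by
  simp_rw [Q_pow n _ hn]
  exact (phi_sum s hs hs2 n hn).1.mul_left _

lemma DD_bound (n : ℕ) (hn : 0 < n) (s : ℝ) (hs : 1 ≤ s) (hs2 : s ≤ 2) :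
    |DD n s| ≤ 8 * π * (1 / (n : ℝ) ^ 2) := by
  have h0 : (0 : ℝ) < n := by positivity
  have e : DD n s = (n : ℝ) ^ (-(2 * s)) *
      (∑' m : ℤ, phi s (((n : ℝ) / 2 + m) / n) - n * cc s) := by
    rw [DD, FF]
    simp_rw [Q_pow n _ hn]
    rw [tsum_mul_left, show 1 - 2 * s = -(2 * s) + 1 by ring, Real.rpow_add h0, Real.rpow_one]
    ring
  rw [e, abs_mul, abs_of_pos (by positivity), mul_comm]
  have h1 : (n : ℝ) ^ (-(2 * s)) ≤ 1 / (n : ℝ) ^ 2 := by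
    rw [show (1 : ℝ) / (n : ℝ) ^ 2 = (n : ℝ) ^ (-2 : ℝ) by
      rw [Real.rpow_neg h0.le]; simp]
    apply Real.rpow_le_rpow_of_exponent_le
    · exact_mod_cast hn
    · linarith
  have := (phi_sum s hs hs2 n hn).2
  gcongr

lemma near1 : ∀ᶠ s in 𝓝[>] (1 : ℝ), 1 < s ∧ s ≤ 2 := by
  filter_upwards [Ioc_mem_nhdsGT (show (1 : ℝ) < 2 by norm_num)] with s hs using hs

lemma cc_tendsto : Tendsto cc (𝓝[>] 1) (𝓝 (cc 1)) := by
  have h := H_deriv.continuousAt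
  have h2 : ContinuousAt (fun s : ℝ => (3 : ℝ) ^ (-(s - 1)) * ((3 : ℝ) ^ (s - 1) * cc s)) 1 := by
    refine ContinuousAt.mul ?_ h
    refine ContinuousAt.rpow continuousAt_const (by fun_prop) (Or.inl (by norm_num))
  have h3 : (fun s : ℝ => (3 : ℝ) ^ (-(s - 1)) * ((3 : ℝ) ^ (s - 1) * cc s)) = cc := by
    funext s
    rw [← mul_assoc, ← Real.rpow_add (by norm_num)]
    simp
  rw [h3] at h2
  exact h2.tendsto.mono_left nhdsWithin_le_nhds

lemma FF_tendsto (n : ℕ) (hn : 0 < n) : Tendsto (fun s => FF n s) (𝓝[>] 1) (𝓝 (FF n 1)) := by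
  have hQ : ∀ m : ℤ, (1 : ℝ) ≤ ((Q ((n : ℤ), m) : ℤ) : ℝ) := by
    intro m
    have : (0 : ℝ) < ((Q ((n : ℤ), m) : ℤ) : ℝ) := by
      rw [Q_real n m hn]; positivity
    have h2 : 0 < Q ((n : ℤ), m) := by exact_mod_cast this
    have h3 : 1 ≤ Q ((n : ℤ), m) := h2
    exact_mod_cast h3
  unfold FF
  refine tendsto_tsum_of_dominated_convergence
    (bound := fun m : ℤ => ((Q ((n : ℤ), m) : ℤ) : ℝ) ^ (-(1:ℝ)))
    (FF_summable n hn 1 le_rfl (by norm_num)) ?_ ?_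
  · intro m
    have : ContinuousAt (fun s : ℝ => ((Q ((n : ℤ), m) : ℤ) : ℝ) ^ (-s)) 1 :=
      ContinuousAt.rpow continuousAt_const (by fun_prop) (Or.inl (by linarith [hQ m]))
    exact this.tendsto.mono_left nhdsWithin_le_nhds
  · filter_upwards [near1] with s hs m
    have := hQ m
    rw [Real.norm_of_nonneg (by positivity)]
    exact Real.rpow_le_rpow_of_exponent_le this (by linarith)

lemma DD_tendsto (n : ℕ) (hn : 0 < n) : Tendsto (fun s => DD n s) (𝓝[>] 1) (𝓝 (DD n 1)) := by
  unfold DD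
  refine (FF_tendsto n hn).sub (Tendsto.mul ?_ cc_tendsto)
  have : ContinuousAt (fun s : ℝ => (n : ℝ) ^ (1 - 2 * s)) 1 :=
    ContinuousAt.rpow continuousAt_const (by fun_prop) (Or.inl (by positivity))
  exact this.tendsto.mono_left nhdsWithin_le_nhds

lemma bd_summable : Summable (fun n : ℕ => 8 * π * (1 / ((n + 1 : ℕ) : ℝ) ^ 2)) := by
  apply Summable.mul_left
  exact (summable_nat_add_iff (f := fun n : ℕ => 1 / (n : ℝ) ^ 2) 1).2
    (Real.summable_one_div_nat_pow.2 (by norm_num))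

lemma DD_summable (s : ℝ) (hs : 1 ≤ s) (hs2 : s ≤ 2) : Summable (fun n : ℕ => DD (n + 1) s) :=
  Summable.of_norm_bounded bd_summable (fun n => DD_bound (n + 1) (by simp) s hs hs2)

lemma sumDD_tendsto : Tendsto (fun s => ∑' n : ℕ, DD (n + 1) s) (𝓝[>] 1)
    (𝓝 (∑' n : ℕ, DD (n + 1) 1)) := by
  refine tendsto_tsum_of_dominated_convergence bd_summable
    (fun n => DD_tendsto (n + 1) (by simp)) ?_
  filter_upwards [near1] with s hs n
  exact DD_bound (n + 1) (by simp) s hs.1.le hs.2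

lemma zeta_real (t : ℝ) (ht : 1 < t) : riemannZeta t = ((∑' n : ℕ, ((n : ℝ) + 1) ^ (-t) : ℝ) : ℂ) := by
  rw [zeta_eq_tsum_one_div_nat_add_one_cpow (by simpa using ht), Complex.ofReal_tsum]
  congr 1 with n
  rw [Real.rpow_neg (by positivity), Complex.ofReal_inv, Complex.ofReal_cpow (by positivity), one_div]
  norm_cast

lemma zl_sum (t : ℝ) (ht : 1 < t) : Summable (fun n : ℕ => ((n : ℝ) + 1) ^ (-t)) := by
  have := (summable_nat_add_iff (f := fun n : ℕ => (n : ℝ) ^ (-t)) 1).2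
    (Real.summable_nat_rpow.2 (by linarith))
  simpa using this

lemma FF_even (s : ℝ) : Function.Even (fun n : ℤ => FF n s) := by
  intro n
  simp only [FF]
  rw [← (Equiv.neg ℤ).tsum_eq]
  congr 1
  funext m
  simp [Q]

lemma FF_zero (s : ℝ) (hs : 1 < s) : FF 0 s = 2 * ∑' n : ℕ, ((n : ℝ) + 1) ^ (-(2 * s)) := by
  have e : ∀ m : ℤ, ((Q (0, m) : ℤ) : ℝ) ^ (-s) = |(m : ℝ)| ^ (-(2 * s)) := by
    intro m
    simp only [Q]
    push_cast
    rw [show ((0 : ℝ) + 0 * (m : ℝ) + (m : ℝ) ^ 2) = |(m : ℝ)| ^ 2 by simp,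
      ← Real.rpow_natCast, ← Real.rpow_mul (by positivity)]
    congr 1
    push_cast; ring
  unfold FF
  simp_rw [e]
  have h := zl_sum (2 * s) (by linarith)
  have h2 : HasSum (fun m : ℤ => |(m : ℝ)| ^ (-(2 * s))) _ :=
    HasSum.of_add_one_of_neg_add_one (f := fun m : ℤ => |(m : ℝ)| ^ (-(2 * s)))
      (m := ∑' n : ℕ, ((n : ℝ) + 1) ^ (-(2 * s))) (m' := ∑' n : ℕ, ((n : ℝ) + 1) ^ (-(2 * s)))
      (by
        convert h.hasSum using 3 with n
        push_cast
        rw [abs_of_nonneg (by positivity)])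
      (by
        convert h.hasSum using 3 with n
        push_cast
        rw [abs_neg, abs_of_nonneg (by positivity)])
  rw [h2.tsum_eq]
  simp only [Int.cast_zero, abs_zero]
  rw [Real.zero_rpow (by linarith)]
  ring

theorem zetaL2 (χ : DirichletCharacter ℂ 3) (hχ : χ ≠ 1) (s : ℝ) (hs : 1 < s) (hs2 : s ≤ 2) :
    riemannZeta s * DirichletCharacter.LFunction χ s =
      (1 / 3) * (riemannZeta (2 * s : ℝ) + ((∑' n : ℕ, DD (n + 1) s : ℝ) : ℂ)
        + riemannZeta (2 * s - 1 : ℝ) * (cc s : ℂ)) := by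
  obtain ⟨hS, h⟩ := zetaL χ hχ s hs
  rw [h, zeta_real _ (by linarith), zeta_real _ (by linarith), hS.tsum_prod]
  have h1 := tsum_int_eq_zero_add_two_mul_tsum_pnat (FF_even s) hS.prod
  have h2 : ∑' n : ℕ+, FF ((n : ℕ) : ℤ) s = ∑' n : ℕ, FF ((n + 1 : ℕ) : ℤ) s :=
    tsum_pnat_eq_tsum_succ (f := fun n : ℕ => FF n s)
  have h3 : ∑' n : ℕ, FF ((n + 1 : ℕ) : ℤ) s = ∑' n : ℕ, DD (n + 1) s +
      (∑' n : ℕ, ((n : ℝ) + 1) ^ (-(2 * s - 1))) * cc s := by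
    rw [← tsum_mul_right, ← (DD_summable s hs.le hs2).tsum_add
      ((zl_sum (2 * s - 1) (by linarith)).mul_right _)]
    congr 1
    funext n
    rw [DD, neg_sub]
    push_cast
    ring
  have h4 : ∑' (b : ℤ) (c : ℤ), ((Q (b, c) : ℤ) : ℝ) ^ (-s) = 2 * ∑' n : ℕ, ((n : ℝ) + 1) ^ (-(2 * s))
      + 2 * (∑' n : ℕ, DD (n + 1) s + (∑' n : ℕ, ((n : ℝ) + 1) ^ (-(2 * s - 1))) * cc s) := by
    rw [← FF_zero s hs, ← h3, ← h2]
    rw [nsmul_eq_mul] at h1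
    exact_mod_cast h1
  rw [h4]
  push_cast
  ring

end St6

namespace St6
open MeasureTheory Filter Topology

lemma cot_sum (w v : ℂ) (hw : w ∈ Complex.integerComplement) (hv : v ∈ Complex.integerComplement)
    (hwv : w - v ≠ 0) (f : ℤ → ℂ) (hf : ∀ m : ℤ, f m = 1 / ((m + w) * (m + v))) (hs : Summable f) :
    ∑' m : ℤ, f m = (π * cot (π * v) - π * cot (π * w)) / (w - v) := by
  have h1 := cot_series_rep' hw
  have h2 := cot_series_rep' hv
  have s1 := summable_cotTerm hw
  have s2 := summable_cotTerm hv
  simp only [cotTerm] at s1 s2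
  have p1 : Summable (fun n : ℕ => f (n + 1)) :=
    hs.comp_injective (i := fun n : ℕ => (n : ℤ) + 1) (fun a b h => by simpa using h)
  have p2 : Summable (fun n : ℕ => f (-(n + 1))) :=
    hs.comp_injective (i := fun n : ℕ => -((n : ℤ) + 1)) (fun a b h => by simpa using h)
  rw [(HasSum.of_add_one_of_neg_add_one p1.hasSum p2.hasSum).tsum_eq]
  have nz : ∀ x ∈ Complex.integerComplement, ∀ m : ℤ, x + (m : ℂ) ≠ 0 := fun x hx m h =>
    hx ⟨-m, by push_cast; linear_combination -h⟩
  have key : ∀ n : ℕ, f (n + 1) + f (-(n + 1)) =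
      ((1 / (v - (n + 1)) + 1 / (v + (n + 1))) - (1 / (w - (n + 1)) + 1 / (w + (n + 1)))) / (w - v) := by
    intro n
    have a1 := nz w hw (n + 1)
    have a2 := nz v hv (n + 1)
    have a3 := nz w hw (-(n + 1))
    have a4 := nz v hv (-(n + 1))
    push_cast at a1 a2 a3 a4
    rw [hf, hf]
    push_cast
    rw [show (n : ℂ) + 1 + w = w + (n + 1) by ring, show (n : ℂ) + 1 + v = v + (n + 1) by ring,
      show -((n : ℂ) + 1) + w = w + -(n + 1) by ring, show -((n : ℂ) + 1) + v = v + -(n + 1) by ring,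
      sub_eq_add_neg v, sub_eq_add_neg w ((n : ℂ) + 1)]
    generalize (n : ℂ) + 1 = k at *
    rw [eq_div_iff hwv]
    field_simp
    ring
  have h3 : ∑' n : ℕ, f (n + 1) + ∑' n : ℕ, f (-(n + 1)) =
      ((π * cot (π * v) - 1 / v) - (π * cot (π * w) - 1 / w)) / (w - v) := by
    rw [← p1.tsum_add p2, h1, h2, ← s2.tsum_sub s1, ← tsum_div_const]
    exact tsum_congr key
  have b1 := nz w hw 0
  have b2 := nz v hv 0
  simp only [Int.cast_zero, add_zero] at b1 b2
  rw [add_right_comm, h3, hf]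
  rw [eq_div_iff hwv, add_mul, div_mul_cancel₀ _ hwv]
  simp only [Int.cast_zero, zero_add]
  field_simp
  ring

lemma cot_val (z q : ℂ) (hq : Complex.exp (2 * π * I * z) = q) :
    cot (π * z) = (q + 1) / (I * (1 - q)) := by
  rw [Complex.cot_pi_eq_exp_ratio, hq]

end St6

namespace St6
open MeasureTheory Filter Topology

lemma DD_one (n : ℕ) (hn : 0 < n) :
    DD n 1 = -(4 * π / √3) * ((-1 : ℝ) ^ n / (n * ((-1 : ℝ) ^ n - Real.exp (√3 * π * n)))) := by
  have hn0 : (0 : ℝ) < n := by positivity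
  have h3 : (0 : ℝ) < √3 := by positivity
  have h33 : ((√3 : ℝ) : ℂ) ^ 2 = 3 := by
    rw [← Complex.ofReal_pow, Real.sq_sqrt (by norm_num)]; simp
  set y : ℝ := √3 / 2 * n with hy
  have hy0 : 0 < y := by positivity
  set w : ℂ := (n : ℂ) / 2 + y * I with hw
  set v : ℂ := (n : ℂ) / 2 - y * I with hv
  have him1 : w.im = y := by
    rw [hw, show (n : ℂ) / 2 = ((n / 2 : ℝ) : ℂ) by push_cast; ring]
    simp
  have him2 : v.im = -y := by
    rw [hv, show (n : ℂ) / 2 = ((n / 2 : ℝ) : ℂ) by push_cast; ring]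
    simp
  have mw : w ∈ Complex.integerComplement := by
    rintro ⟨k, hk⟩
    rw [← hk] at him1
    simp at him1
    linarith
  have mv : v ∈ Complex.integerComplement := by
    rintro ⟨k, hk⟩
    rw [← hk] at him2
    simp at him2
    linarith
  have hwv : w - v = 2 * y * I := by rw [hw, hv]; ring
  have hyC : (y : ℂ) ≠ 0 := by exact_mod_cast hy0.ne'
  have hwv0 : w - v ≠ 0 := by
    rw [hwv]; simp [hyC]
  have hS := FF_summable n hn 1 le_rfl (by norm_num)
  have hFF : ((FF n 1 : ℝ) : ℂ) = (π * cot (π * v) - π * cot (π * w)) / (w - v) := by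
    rw [FF, Complex.ofReal_tsum]
    refine cot_sum w v mw mv hwv0 _ ?_ (Complex.ofRealCLM.summable hS)
    intro m
    rw [Real.rpow_neg_one, Complex.ofReal_inv, one_div]
    congr 1
    simp only [Q, hw, hv, hy]
    push_cast
    linear_combination (-(n : ℂ) ^ 2 / 4) * h33 + ((√3 : ℝ) : ℂ) ^ 2 * (n : ℂ) ^ 2 / 4 * I_sq
  set e : ℝ := (-1) ^ n with he
  have hee : e * e = 1 := by rw [he, ← mul_pow]; simp
  set E : ℝ := Real.exp (√3 * π * n) with hE
  have hE1 : 1 < E := by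
    rw [hE]; apply Real.one_lt_exp_iff.2; positivity
  have hexp1 : Complex.exp (n * (π * I)) = (e : ℂ) := by
    rw [Complex.exp_nat_mul, Complex.exp_pi_mul_I, he]; push_cast; rfl
  have qw : Complex.exp (2 * π * I * w) = (e / E : ℝ) := by
    rw [show 2 * π * I * w = n * (π * I) + ((-(√3 * π * n) : ℝ) : ℂ) by
      rw [hw, hy]; push_cast; linear_combination (π * √3 * n : ℂ) * I_sq]
    rw [Complex.exp_add, hexp1, ← Complex.ofReal_exp, Real.exp_neg, ← hE]
    push_cast; rfl
  have qv : Complex.exp (2 * π * I * v) = (e * E : ℝ) := by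
    rw [show 2 * π * I * v = n * (π * I) + ((√3 * π * n : ℝ) : ℂ) by
      rw [hv, hy]; push_cast; linear_combination -(π * √3 * n : ℂ) * I_sq]
    rw [Complex.exp_add, hexp1, ← Complex.ofReal_exp, ← hE]
    push_cast; rfl
  rw [cot_val _ _ qw, cot_val _ _ qv, hwv] at hFF
  have he1 : e = 1 ∨ e = -1 := by
    rcases neg_one_pow_eq_or ℝ n with h | h
    · left; rw [he, h]
    · right; rw [he, h]
  have d1 : E - e ≠ 0 := by rcases he1 with h | h <;> rw [h] <;> linarith
  have hFR : FF n 1 = π / y * ((E + e) / (E - e)) := by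
    have d1C : (E : ℂ) - e ≠ 0 := by exact_mod_cast d1
    have hEC : (E : ℂ) ≠ 0 := by exact_mod_cast (by linarith : E ≠ 0)
    have : ((FF n 1 : ℝ) : ℂ) = ((π / y * ((E + e) / (E - e)) : ℝ) : ℂ) := by
      rw [hFF]
      push_cast
      have heeC : (e : ℂ) * e = 1 := by exact_mod_cast hee
      have he0 : (e : ℂ) ≠ 0 := left_ne_zero_of_mul_eq_one heeC
      have t1 : ((e : ℂ) * E + 1) / (I * (1 - e * E)) = I * ((E + e) / (E - e)) := by
        have d2 : (1 : ℂ) - e * E ≠ 0 := by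
          intro h; apply d1C; linear_combination (-(e : ℂ)) * h + (- (E : ℂ)) * heeC
        rw [div_eq_iff (by simp [d2]), mul_comm I ((E + e : ℂ) / (E - e)), div_mul_eq_mul_div,
          div_mul_eq_mul_div, eq_div_iff d1C]
        linear_combination (-(E + e : ℂ) * (1 - e * E)) * I_sq + (-2 * E : ℂ) * heeC
      have t2 : ((e : ℂ) / E + 1) / (I * (1 - e / E)) = -I * ((E + e) / (E - e)) := by
        have d2 : (1 : ℂ) - e / E ≠ 0 := by
          intro h; apply d1C; field_simp at h; linear_combination h
        rw [div_eq_iff (by simp [d2])]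
        field_simp
        linear_combination (E + e : ℂ) * (I_sq)
      rw [t1, t2]
      field_simp
      ring
    exact_mod_cast this
  rw [DD, hFR, cc_one, hy]
  rw [show (1 : ℝ) - 2 * 1 = -1 by norm_num, Real.rpow_neg_one]
  have d3 : e - E ≠ 0 := fun h => d1 (by linarith)
  rw [show e - E = -(E - e) by ring]
  field_simp
  ring

end St6

namespace St6
open MeasureTheory Filter Topology

lemma zeta_lim1 : Tendsto (fun s : ℝ => riemannZeta s - 1 / ((s : ℂ) - 1)) (𝓝[>] 1)
    (𝓝 (Real.eulerMascheroniConstant : ℂ)) := by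
  refine tendsto_riemannZeta_sub_one_div.comp ?_
  refine tendsto_nhdsWithin_iff.2 ⟨?_, ?_⟩
  · have : ContinuousAt (fun s : ℝ => (s : ℂ)) 1 := by fun_prop
    simpa using this.tendsto.mono_left (nhdsWithin_le_nhds (s := Set.Ioi 1))
  · filter_upwards [near1] with s hs
    simp only [Set.mem_compl_iff, Set.mem_singleton_iff]
    exact_mod_cast hs.1.ne'

lemma zeta_lim2 : Tendsto (fun s : ℝ => riemannZeta (2 * s - 1 : ℝ) - 1 / (2 * ((s : ℂ) - 1)))
    (𝓝[>] 1) (𝓝 (Real.eulerMascheroniConstant : ℂ)) := by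
  have : Tendsto (fun s : ℝ => 2 * s - 1) (𝓝[>] 1) (𝓝[>] 1) := by
    refine tendsto_nhdsWithin_iff.2 ⟨?_, ?_⟩
    · have : ContinuousAt (fun s : ℝ => 2 * s - 1) 1 := by fun_prop
      have h := this.tendsto.mono_left (nhdsWithin_le_nhds (s := Set.Ioi 1))
      norm_num at h
      exact h
    · filter_upwards [near1] with s hs
      simp only [Set.mem_Ioi]
      linarith [hs.1]
  refine (zeta_lim1.comp this).congr fun s => ?_
  simp only [Function.comp]
  congr 2
  push_cast
  ring

lemma zeta_lim3 : Tendsto (fun s : ℝ => riemannZeta (2 * s : ℝ)) (𝓝[>] 1) (𝓝 ((π : ℂ) ^ 2 / 6)) := by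
  have h1 : ContinuousAt riemannZeta ((2 * (1 : ℝ) : ℝ) : ℂ) :=
    (differentiableAt_riemannZeta (by norm_num)).continuousAt
  have h2 : ContinuousAt (fun s : ℝ => ((2 * s : ℝ) : ℂ)) 1 := by fun_prop
  have := (ContinuousAt.comp (f := fun s : ℝ => ((2 * s : ℝ) : ℂ)) h1 h2).tendsto.mono_left
    (nhdsWithin_le_nhds (s := Set.Ioi 1))
  rw [← riemannZeta_two]
  simpa [Function.comp_def] using this

theorem main (χ : DirichletCharacter ℂ 3) (hχ : χ ≠ 1) :
    deriv (fun s : ℂ => (3 : ℂ) ^ s * DirichletCharacter.LFunction χ s) 1 =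
      (π : ℂ) ^ 2 / 6 + ((∑' n : ℕ, DD (n + 1) 1 : ℝ) : ℂ)
        + (Real.eulerMascheroniConstant : ℂ) * ((π / √3 : ℝ) : ℂ) := by
  set G : ℂ → ℂ := fun s : ℂ => (3 : ℂ) ^ s * DirichletCharacter.LFunction χ s with hG
  have dG : DifferentiableAt ℂ G ((1 : ℝ) : ℂ) := by
    apply DifferentiableAt.mul
    · exact (differentiableAt_id).const_cpow (Or.inl (by norm_num))
    · exact (DirichletCharacter.differentiable_LFunction hχ) _
  have hGd : HasDerivAt (fun s : ℝ => G s) (deriv G 1) 1 := by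
    have := dG.hasDerivAt.comp_ofReal
    simpa using this
  set Hc : ℝ → ℂ := fun s : ℝ => (((3 : ℝ) ^ (s - 1) * cc s : ℝ) : ℂ) with hHc
  have hHd : HasDerivAt Hc 0 1 := by
    have := H_deriv.ofReal_comp
    rw [Complex.ofReal_zero] at this
    exact this
  have hKd : HasDerivAt (fun s : ℝ => G s - Hc s / 2) (deriv G 1) 1 := by
    refine (hGd.sub (hHd.div_const 2)).congr_deriv (by simp)
  set K : ℝ → ℂ := fun s : ℝ => G s - Hc s / 2 with hK
  have tG := hGd.continuousAt.tendsto.mono_left (nhdsWithin_le_nhds (s := Set.Ioi 1))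
  have tH := hHd.continuousAt.tendsto.mono_left (nhdsWithin_le_nhds (s := Set.Ioi 1))
  have tK := hKd.continuousAt.tendsto.mono_left (nhdsWithin_le_nhds (s := Set.Ioi 1))
  have tD := (Complex.continuous_ofReal.tendsto _).comp sumDD_tendsto
  have t3 : Tendsto (fun s : ℝ => (((3 : ℝ) ^ (s - 1) : ℝ) : ℂ)) (𝓝[>] 1) (𝓝 1) := by
    have : ContinuousAt (fun s : ℝ => (3 : ℝ) ^ (s - 1)) 1 :=
      ContinuousAt.rpow continuousAt_const (by fun_prop) (Or.inl (by norm_num))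
    have h := this.tendsto.mono_left (nhdsWithin_le_nhds (s := Set.Ioi 1))
    have h' := (Complex.continuous_ofReal.tendsto _).comp h
    simpa [Function.comp_def] using h'
  have tM := ((t3.mul (zeta_lim3.add tD)).sub (zeta_lim1.mul tG)).add (zeta_lim2.mul tH)
  have tQ : Tendsto (fun s : ℝ => K s / ((s : ℂ) - 1)) (𝓝[>] 1) (𝓝 (1 * ((π : ℂ) ^ 2 / 6 + ((∑' n : ℕ, DD (n + 1) 1 : ℝ) : ℂ)) -
      (Real.eulerMascheroniConstant : ℂ) * G (1 : ℝ) + (Real.eulerMascheroniConstant : ℂ) * Hc 1)) := by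
    refine tM.congr' ?_
    filter_upwards [near1] with s hs
    have hz := zetaL2 χ hχ s hs.1 hs.2
    have hs0 : (s : ℂ) - 1 ≠ 0 := by
      rw [sub_ne_zero]; exact_mod_cast hs.1.ne'
    have h3s : (3 : ℂ) ^ (s : ℂ) = 3 * (((3 : ℝ) ^ (s - 1) : ℝ) : ℂ) := by
      rw [Complex.ofReal_cpow (by norm_num)]
      push_cast
      rw [Complex.cpow_sub _ _ (by norm_num), Complex.cpow_one]
      ring
    simp only [hK, hG, hHc, Function.comp]
    rw [h3s, Complex.ofReal_mul ((3 : ℝ) ^ (s - 1)) (cc s)]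
    generalize (((3 : ℝ) ^ (s - 1) : ℝ) : ℂ) = T at *
    generalize riemannZeta (2 * s : ℝ) = Z2 at *
    generalize riemannZeta (2 * s - 1 : ℝ) = Z1 at *
    generalize riemannZeta s = Z at *
    generalize DirichletCharacter.LFunction χ s = L at *
    field_simp
    linear_combination (-6 * T * ((s : ℂ) - 1)) * hz
  have hK1 : K 1 = 0 := by
    have t0 : Tendsto (fun s : ℝ => (s : ℂ) - 1) (𝓝[>] 1) (𝓝 0) := by
      have : ContinuousAt (fun s : ℝ => (s : ℂ) - 1) 1 := by fun_prop
      simpa using this.tendsto.mono_left (nhdsWithin_le_nhds (s := Set.Ioi 1))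
    have h := tQ.mul t0
    rw [mul_zero] at h
    refine tendsto_nhds_unique tK (h.congr' ?_)
    filter_upwards [near1] with s hs
    have hs0 : (s : ℂ) - 1 ≠ 0 := by
      rw [sub_ne_zero]; exact_mod_cast hs.1.ne'
    field_simp
  have tS : Tendsto (fun s : ℝ => K s / ((s : ℂ) - 1)) (𝓝[>] 1) (𝓝 (deriv G 1)) := by
    have h := (hasDerivAt_iff_tendsto_slope.1 hKd).mono_left
      (nhdsWithin_mono 1 (fun x (hx : (1 : ℝ) < x) => (by simpa using hx.ne' : x ∈ ({1}ᶜ : Set ℝ))))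
    refine h.congr fun s => ?_
    rw [slope_def_module, hK1, sub_zero, Complex.real_smul]
    push_cast
    rw [div_eq_inv_mul]
  rw [tendsto_nhds_unique tS tQ]
  have hH1 : Hc 1 = ((2 * (π / √3) : ℝ) : ℂ) := by
    simp only [hHc, cc_one]
    congr 1
    simp
    ring
  have hG1 : G (1 : ℝ) = ((π / √3 : ℝ) : ℂ) := by
    have : G (1 : ℝ) - Hc 1 / 2 = 0 := hK1
    rw [hH1] at this
    push_cast at this ⊢
    linear_combination this
  rw [hH1, hG1]
  push_cast
  ring

end St6

theorem stmt6 (χ : DirichletCharacter ℂ 3) (hχ : χ ≠ 1) :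
    deriv (fun s : ℂ => (3 : ℂ) ^ s * DirichletCharacter.LFunction χ s) 1 =
      (((π / Real.sqrt 3) * (π / (2 * Real.sqrt 3) + Real.eulerMascheroniConstant -
        4 * ∑' ℓ : ℕ, (-1 : ℝ) ^ (ℓ + 1) /
          ((ℓ + 1) * ((-1 : ℝ) ^ (ℓ + 1) - Real.exp (Real.sqrt 3 * π * (ℓ + 1)))) : ℝ)) : ℂ) := by
  rw [St6.main χ hχ]
  have h : ∑' n : ℕ, St6.DD (n + 1) 1 = -(4 * π / √3) * ∑' ℓ : ℕ, (-1 : ℝ) ^ (ℓ + 1) /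
          ((ℓ + 1) * ((-1 : ℝ) ^ (ℓ + 1) - Real.exp (Real.sqrt 3 * π * (ℓ + 1)))) := by
    rw [← tsum_mul_left]
    congr 1
    funext n
    rw [St6.DD_one (n + 1) (by simp)]
    push_cast
    rfl
  rw [h]
  generalize (∑' ℓ : ℕ, (-1 : ℝ) ^ (ℓ + 1) /
          ((ℓ + 1) * ((-1 : ℝ) ^ (ℓ + 1) - Real.exp (Real.sqrt 3 * π * (ℓ + 1))))) = S
  have e : π ^ 2 / 6 + -(4 * π / √3) * S + Real.eulerMascheroniConstant * (π / √3) =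
      (π / √3) * (π / (2 * √3) + Real.eulerMascheroniConstant - 4 * S) := by
    have h1 : (π / √3) * (π / (2 * √3)) = π ^ 2 / 6 := by
      rw [div_mul_div_comm, show √3 * (2 * √3) = 2 * (√3 * √3) by ring,
        Real.mul_self_sqrt (by norm_num)]
      ring
    rw [← h1]
    ring
  have eC := congrArg (fun x : ℝ => (x : ℂ)) e
  push_cast at eC ⊢
  exact eC
end
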